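/- arXiv:1807.02533 — 11 statements merged into one kernel-verified Lean document; each statement's English description precedes it below -/
import Mathlib

section
/- Let A be a unital C*-algebra, K a complex Hilbert space, φ : A → B(K) a completely positive map, a, a₁, …, aₙ ∈ A, and v₁, …, vₙ ∈ K. Then Σ_{i,j=1}^{n} ⟨vᵢ, φ(aᵢ* a* a aⱼ) vⱼ⟩ ≤ ‖a‖² · Σ_{i,j=1}^{n} ⟨vᵢ, φ(aᵢ* aⱼ) vⱼ⟩ (both sides being nonnegative real numbers). -/
open scoped ComplexOrder ComplexInnerProductSpace

noncomputable section

/-- A linear map `φ : A → B(K)` into the bounded operators on a complex Hilbert space is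
*completely positive* if for every `n`, the entrywise induced map on `n × n` matrices sends
positive elements of `Mₙ(A)` (those of the form `star B * B`) to positive elements of
`Mₙ(B(K))`, positivity of an operator matrix being expressed by nonnegativity of the
associated quadratic form on `K ⊕ ⋯ ⊕ K`. -/
def IsCPMap {A : Type*} [Ring A] [StarRing A] [Algebra ℂ A]
    {K : Type*} [NormedAddCommGroup K] [InnerProductSpace ℂ K]
    (φ : A →ₗ[ℂ] (K →L[ℂ] K)) : Prop :=
  ∀ (n : ℕ) (M : Matrix (Fin n) (Fin n) A),
    (∃ B : Matrix (Fin n) (Fin n) A, M = star B * B) →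
    ∀ v : Fin n → K, 0 ≤ ∑ i, ∑ j, ⟪v i, (φ (M i j)) (v j)⟫

/-- Positivity for a row of products `c * b j`. -/
theorem cpMap_aux_nonneg {A : Type*} [CStarAlgebra A]
    {K : Type*} [NormedAddCommGroup K] [InnerProductSpace ℂ K]
    (φ : A →ₗ[ℂ] (K →L[ℂ] K)) (hφ : IsCPMap φ)
    (n : ℕ) (c : A) (b : Fin n → A) (v : Fin n → K) :
    0 ≤ ∑ i, ∑ j, ⟪v i, (φ (star (b i) * (star c * c) * b j)) (v j)⟫ := by
  cases n with
  | zero => simp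
  | succ m =>
    have h := hφ (m + 1) _
      ⟨Matrix.of fun i j => if i = 0 then c * b j else 0, rfl⟩ v
    have key : ∀ i j, (star (Matrix.of fun i j => if i = 0 then c * b j else 0) *
        (Matrix.of fun i j => if i = 0 then c * b j else 0) :
        Matrix (Fin (m + 1)) (Fin (m + 1)) A) i j = star (b i) * (star c * c) * b j := by
      intro i j
      simp [Matrix.mul_apply, Fin.sum_univ_succ, Matrix.star_apply, mul_assoc]
    simpa only [key] using h

/-- The element `‖a‖² - a* a` is of the form `c* c`. -/
theorem exists_star_mul_self_eq_norm_sub {A : Type*} [CStarAlgebra A] (a : A) :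
    ∃ c : A, star c * c = algebraMap ℂ A ((‖a‖ : ℂ) ^ 2) - star a * a := by
  letI := CStarAlgebra.spectralOrder A
  haveI := CStarAlgebra.spectralOrderedRing A
  have h : star a * a ≤ algebraMap ℝ A (‖a‖ ^ 2) := CStarAlgebra.star_mul_le_algebraMap_norm_sq
  obtain ⟨c, hc⟩ := CStarAlgebra.nonneg_iff_eq_star_mul_self.mp (sub_nonneg.mpr h)
  refine ⟨c, ?_⟩
  rw [← hc, IsScalarTower.algebraMap_apply ℝ ℂ A]
  simp

/-- If `φ : A → B(K)` is completely positive, then for `a, a₁, …, aₙ ∈ A`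
and `v₁, …, vₙ ∈ K`,
`∑ᵢⱼ ⟪vᵢ, φ(aᵢ* a* a aⱼ) vⱼ⟫ ≤ ‖a‖² ∑ᵢⱼ ⟪vᵢ, φ(aᵢ* aⱼ) vⱼ⟫`,
both sides being nonnegative real numbers (inequality in the complex order). -/
theorem sum_inner_cpMap_star_mul_le {A : Type*} [CStarAlgebra A]
    {K : Type*} [NormedAddCommGroup K] [InnerProductSpace ℂ K] [CompleteSpace K]
    (φ : A →ₗ[ℂ] (K →L[ℂ] K)) (hφ : IsCPMap φ)
    (n : ℕ) (a : A) (b : Fin n → A) (v : Fin n → K) :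
    0 ≤ ∑ i, ∑ j, ⟪v i, (φ (star (b i) * (star a * a) * b j)) (v j)⟫ ∧
    ∑ i, ∑ j, ⟪v i, (φ (star (b i) * (star a * a) * b j)) (v j)⟫ ≤
      (‖a‖ : ℂ) ^ 2 * ∑ i, ∑ j, ⟪v i, (φ (star (b i) * b j)) (v j)⟫ := by
  refine ⟨cpMap_aux_nonneg φ hφ n a b v, ?_⟩
  obtain ⟨c, hc⟩ := exists_star_mul_self_eq_norm_sub a
  have h := cpMap_aux_nonneg φ hφ n c b v
  rw [← sub_nonneg]
  convert h using 1
  simp only [hc, Finset.mul_sum, ← Finset.sum_sub_distrib]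
  refine Finset.sum_congr rfl fun i _ => Finset.sum_congr rfl fun j _ => ?_
  rw [mul_sub, sub_mul, Algebra.algebraMap_eq_smul_one]
  simp only [mul_smul_comm, smul_mul_assoc, mul_one, map_sub, map_smul,
    ContinuousLinearMap.sub_apply, ContinuousLinearMap.smul_apply, inner_sub_right,
    inner_smul_right]
end
end

section
/- Every completely positive map φ : A → B(K), where A is a unital C*-algebra and K is a complex Hilbert space, admits a minimal Stinespring representation: there exist a complex Hilbert space H, a unital *-homomorphism π : A → B(H), and a bounded linear map V : K → H with ‖V v‖² ≤ ‖φ(1)‖ · ‖v‖² for all v ∈ K, such that φ(a) = V* ∘ π(a) ∘ V for all a ∈ A and the linear span of {π(a)(V v) : a ∈ A, v ∈ K} is dense in H. Moreover, if φ is unital then V is an isometry. -/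
open scoped ComplexOrder ComplexInnerProductSpace

noncomputable section

universe u v

/-- A *Stinespring representation* of `φ : A → B(K)`: a complex Hilbert space `carrier`,
a unital `*`-homomorphism `rep : A → B(carrier)` and a bounded linear map
`embed : K → carrier` with `φ(a) = embed* ∘ rep(a) ∘ embed` for all `a ∈ A`. -/
structure StinespringRep {A : Type u} [CStarAlgebra A] {K : Type v}
    [NormedAddCommGroup K] [InnerProductSpace ℂ K] [CompleteSpace K]
    (φ : A →ₗ[ℂ] (K →L[ℂ] K)) where
  carrier : Type (max u v)
  [nacg : NormedAddCommGroup carrier]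
  [ips : InnerProductSpace ℂ carrier]
  [cs : CompleteSpace carrier]
  rep : A →⋆ₐ[ℂ] (carrier →L[ℂ] carrier)
  embed : K →L[ℂ] carrier
  stinespring : ∀ a : A,
    φ a = (ContinuousLinearMap.adjoint embed).comp ((rep a).comp embed)

attribute [instance] StinespringRep.nacg StinespringRep.ips StinespringRep.cs

open scoped TensorProduct
open UniformSpace

section StAux

variable {A : Type u} [CStarAlgebra A]
    {K : Type v} [NormedAddCommGroup K] [InnerProductSpace ℂ K]

/-- The sesquilinear form `⟨a ⊗ v, b ⊗ w⟩ = ⟪v, φ (a* b) w⟫` on `A ⊗ K`. -/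
def stForm (φ : A →ₗ[ℂ] (K →L[ℂ] K)) : (A ⊗[ℂ] K) →ₗ⋆[ℂ] (A ⊗[ℂ] K) →ₗ[ℂ] ℂ :=
  TensorProduct.lift <| LinearMap.mk₂'ₛₗ (starRingEnd ℂ) (starRingEnd ℂ)
    (fun a v => TensorProduct.lift <| LinearMap.mk₂ ℂ (fun b w => ⟪v, φ (star a * b) w⟫)
      (fun b b' w => by simp [mul_add])
      (fun c b w => by simp)
      (fun b w w' => by simp)
      (fun c b w => by simp))
    (fun a a' v => by ext b w; simp [add_mul])
    (fun c a v => by ext b w; simp)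
    (fun a v v' => by ext b w; simp)
    (fun c a v => by ext b w; simp [mul_comm])

theorem stForm_tmul (φ : A →ₗ[ℂ] (K →L[ℂ] K)) (a b : A) (v w : K) :
    stForm φ (a ⊗ₜ v) (b ⊗ₜ w) = ⟪v, φ (star a * b) w⟫ := rfl

theorem st_exists_sum (x : A ⊗[ℂ] K) :
    ∃ (n : ℕ) (a : Fin n → A) (v : Fin n → K), x = ∑ i, a i ⊗ₜ[ℂ] v i := by
  induction x using TensorProduct.induction_on with
  | zero => exact ⟨0, Fin.elim0, Fin.elim0, by simp⟩
  | tmul a v => exact ⟨1, fun _ => a, fun _ => v, by simp⟩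
  | add x y hx hy =>
    obtain ⟨n, a, v, rfl⟩ := hx
    obtain ⟨m, b, w, rfl⟩ := hy
    exact ⟨n + m, Fin.append a b, Fin.append v w, by simp [Fin.sum_univ_add]⟩

theorem stForm_nonneg {φ : A →ₗ[ℂ] (K →L[ℂ] K)} (hφ : IsCPMap φ) (x : A ⊗[ℂ] K) :
    0 ≤ stForm φ x x := by
  obtain ⟨n, a, v, rfl⟩ := st_exists_sum x
  cases n with
  | zero => simp
  | succ n =>
    have h := hφ (n + 1) (Matrix.of fun i j => star (a i) * a j)
      ⟨Matrix.of fun k j => if k = 0 then a j else 0, by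
        ext i j
        rw [Matrix.mul_apply]
        simp [Matrix.star_apply]⟩ v
    rw [Finset.sum_comm] at h
    simpa [map_sum, LinearMap.sum_apply, stForm_tmul] using h

theorem stForm_symm {φ : A →ₗ[ℂ] (K →L[ℂ] K)} (hφ : IsCPMap φ) (x y : A ⊗[ℂ] K) :
    starRingEnd ℂ (stForm φ y x) = stForm φ x y := by
  have im0 : ∀ z, (stForm φ z z).im = 0 := fun z =>
    ((Complex.le_def.1 (stForm_nonneg hφ z)).2).symm
  have h1 := im0 (x + y)
  have h2 := im0 (x + Complex.I • y)
  have hx := im0 x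
  have hy := im0 y
  simp at h1 h2
  apply Complex.ext
  · simp; linarith
  · simp; linarith

theorem stForm_mul (φ : A →ₗ[ℂ] (K →L[ℂ] K)) (a : A) (x y : A ⊗[ℂ] K) :
    stForm φ ((LinearMap.mulLeft ℂ a).rTensor K x) y =
      stForm φ x ((LinearMap.mulLeft ℂ (star a)).rTensor K y) := by
  induction x using TensorProduct.induction_on with
  | zero => simp
  | add x x' hx hx' => simp [hx, hx']
  | tmul b v =>
    induction y using TensorProduct.induction_on with
    | zero => simp
    | add y y' hy hy' => simp only [map_add, hy, hy']
    | tmul c w => simp [stForm_tmul, mul_assoc]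

set_option linter.unusedVariables false in
/-- Type synonym of `A ⊗ K` carrying the semi-inner product induced by `φ`. -/
def StPre (φ : A →ₗ[ℂ] (K →L[ℂ] K)) (hφ : IsCPMap φ) : Type (max u v) := A ⊗[ℂ] K

variable {φ : A →ₗ[ℂ] (K →L[ℂ] K)} (hφ : IsCPMap φ)

instance : AddCommGroup (StPre φ hφ) := inferInstanceAs (AddCommGroup (A ⊗[ℂ] K))
instance : Module ℂ (StPre φ hφ) := inferInstanceAs (Module ℂ (A ⊗[ℂ] K))

/-- The identity map onto the type synonym. -/
def toSt : (A ⊗[ℂ] K) ≃ₗ[ℂ] StPre φ hφ := LinearEquiv.refl ℂ _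

/-- The semi-inner product. -/
abbrev stCore : PreInnerProductSpace.Core ℂ (StPre φ hφ) where
  inner x y := stForm φ ((toSt hφ).symm x) ((toSt hφ).symm y)
  conj_inner_symm _ _ := stForm_symm hφ _ _
  re_inner_nonneg _ := (Complex.le_def.1 (stForm_nonneg hφ _)).1
  add_left _ _ _ := by simp
  smul_left _ _ _ := by simp

instance : SeminormedAddCommGroup (StPre φ hφ) :=
  InnerProductSpace.Core.toSeminormedAddCommGroup (c := stCore hφ)
instance : InnerProductSpace ℂ (StPre φ hφ) := InnerProductSpace.ofCore (stCore hφ)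

theorem st_inner (x y : A ⊗[ℂ] K) : ⟪toSt hφ x, toSt hφ y⟫ = stForm φ x y := rfl

theorem st_norm_sq (x : A ⊗[ℂ] K) : ((‖toSt hφ x‖ ^ 2 : ℝ) : ℂ) = stForm φ x x := by
  rw [← st_inner hφ, inner_self_eq_norm_sq_to_K]; simp

theorem st_bound (a : A) (x : A ⊗[ℂ] K) :
    ‖toSt hφ ((LinearMap.mulLeft ℂ a).rTensor K x)‖ ≤ ‖a‖ * ‖toSt hφ x‖ := by
  let _ := CStarAlgebra.spectralOrder A
  have _ := CStarAlgebra.spectralOrderedRing A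
  obtain ⟨b, hb⟩ := CStarAlgebra.nonneg_iff_eq_star_mul_self.1
    (sub_nonneg.2 (CStarAlgebra.star_mul_le_algebraMap_norm_sq (a := a)))
  have h := stForm_nonneg hφ ((LinearMap.mulLeft ℂ b).rTensor K x)
  have key : ∀ c : A, stForm φ ((LinearMap.mulLeft ℂ c).rTensor K x)
      ((LinearMap.mulLeft ℂ c).rTensor K x) =
      stForm φ x ((LinearMap.mulLeft ℂ (star c * c)).rTensor K x) := by
    intro c
    rw [stForm_mul, LinearMap.mulLeft_mul, LinearMap.rTensor_comp]
    rfl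
  have e : (LinearMap.mulLeft ℂ (star b * b)).rTensor K x =
      ((‖a‖ ^ 2 : ℝ) : ℂ) • x - (LinearMap.mulLeft ℂ (star a * a)).rTensor K x := by
    rw [← hb]
    induction x using TensorProduct.induction_on with
    | zero => simp
    | add x y hx hy =>
      rw [map_add, hx (stForm_nonneg hφ _) (fun c => ?_), hy (stForm_nonneg hφ _) (fun c => ?_)]
      · simp only [map_add, smul_add]; abel
      all_goals
        rw [stForm_mul, LinearMap.mulLeft_mul, LinearMap.rTensor_comp]
        rfl
    | tmul c w =>
      simp [sub_mul, TensorProduct.sub_tmul, Algebra.algebraMap_eq_smul_one,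
        TensorProduct.smul_tmul', ← Complex.coe_smul, mul_assoc]
  rw [key, e, map_sub, map_smul, ← key a, ← st_norm_sq hφ, ← st_norm_sq hφ, smul_eq_mul,
    ← Complex.ofReal_mul, ← Complex.ofReal_sub, Complex.zero_le_real] at h
  rw [← sq_le_sq₀ (by positivity) (by positivity), mul_pow]
  linarith

/-- Left multiplication on the pre-Hilbert space. -/
def stMul (a : A) : StPre φ hφ →L[ℂ] StPre φ hφ :=
  ((toSt hφ).toLinearMap ∘ₗ (LinearMap.mulLeft ℂ a).rTensor K ∘ₗ
    (toSt hφ).symm.toLinearMap).mkContinuous ‖a‖ fun x => st_bound hφ a ((toSt hφ).symm x)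

theorem stMul_apply (a : A) (x : A ⊗[ℂ] K) :
    stMul hφ a (toSt hφ x) = toSt hφ ((LinearMap.mulLeft ℂ a).rTensor K x) := rfl

theorem stMul_tmul (a b : A) (v : K) :
    stMul hφ a (toSt hφ (b ⊗ₜ v)) = toSt hφ ((a * b) ⊗ₜ v) := rfl

theorem st_ext {E : Type*} [AddCommGroup E] [Module ℂ E] [TopologicalSpace E]
    {f g : StPre φ hφ →L[ℂ] E}
    (h : ∀ a v, f (toSt hφ (a ⊗ₜ v)) = g (toSt hφ (a ⊗ₜ v))) : f = g := by
  have : f.toLinearMap ∘ₗ (toSt hφ).toLinearMap = g.toLinearMap ∘ₗ (toSt hφ).toLinearMap :=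
    TensorProduct.ext' h
  ext x
  exact LinearMap.congr_fun this ((toSt hφ).symm x)

theorem stMul_mul (a b : A) : stMul hφ (a * b) = stMul hφ a ∘L stMul hφ b :=
  st_ext hφ fun c v => by simp [stMul_tmul, mul_assoc]

theorem stMul_add (a b : A) : stMul hφ (a + b) = stMul hφ a + stMul hφ b :=
  st_ext hφ fun c v => by simp [stMul_tmul, add_mul, TensorProduct.add_tmul]

theorem stMul_smul (c : ℂ) (a : A) : stMul hφ (c • a) = c • stMul hφ a :=
  st_ext hφ fun b v => by
    rw [smul_apply, stMul_tmul, stMul_tmul, smul_mul_assoc,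
      ← TensorProduct.smul_tmul', map_smul]

theorem stMul_zero : stMul hφ 0 = 0 :=
  st_ext hφ fun b v => by simp [stMul_tmul]

theorem stMul_one : stMul hφ 1 = .id ℂ _ :=
  st_ext hφ fun b v => by simp [stMul_tmul]

theorem stMul_inner (a : A) (x y : StPre φ hφ) :
    ⟪stMul hφ (star a) x, y⟫ = ⟪x, stMul hφ a y⟫ := by
  have := stForm_mul φ (star a) ((toSt hφ).symm x) ((toSt hφ).symm y)
  rw [star_star] at this
  exact this

theorem stCompl_ext {f g : Completion (StPre φ hφ) →L[ℂ] Completion (StPre φ hφ)}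
    (h : ∀ x : StPre φ hφ, f x = g x) : f = g := by
  ext c
  induction c using Completion.induction_on with
  | hp => apply isClosed_eq <;> fun_prop
  | ih c => exact h c

/-- The Stinespring representation on the completion. -/
def stRep : A →⋆ₐ[ℂ] (Completion (StPre φ hφ) →L[ℂ] Completion (StPre φ hφ)) where
  toFun a := (stMul hφ a).completion
  map_one' := stCompl_ext hφ fun x => by simp [stMul_one]
  map_mul' a b := stCompl_ext hφ fun x => by simp [stMul_mul]
  map_zero' := stCompl_ext hφ fun x => by
    simp [stMul_zero, Completion.coe_zero]
  map_add' a b := stCompl_ext hφ fun x => by simp [stMul_add, Completion.coe_add]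
  commutes' c := stCompl_ext hφ fun x => by
    simp [Algebra.algebraMap_eq_smul_one, stMul_smul, stMul_one]
  map_star' a := by
    refine (ContinuousLinearMap.eq_adjoint_iff _ _).mpr ?_
    intro x y
    induction x, y using Completion.induction_on₂ with
    | hp => apply isClosed_eq <;> fun_prop
    | ih x y => simp [stMul_inner]

theorem stRep_coe (a : A) (x : StPre φ hφ) :
    stRep hφ a (x : Completion (StPre φ hφ)) = (stMul hφ a x : StPre φ hφ) :=
  by simp [stRep]

theorem st_embed_norm_sq (v : K) :
    ((‖toSt hφ ((1 : A) ⊗ₜ v)‖ ^ 2 : ℝ) : ℂ) = ⟪v, φ 1 v⟫ := by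
  rw [st_norm_sq, stForm_tmul]; simp

theorem st_embed_bound_sq (v : K) :
    ‖toSt hφ ((1 : A) ⊗ₜ v)‖ ^ 2 ≤ ‖φ 1‖ * ‖v‖ ^ 2 := by
  have h := st_embed_norm_sq hφ v
  calc ‖toSt hφ ((1 : A) ⊗ₜ v)‖ ^ 2 = ‖((‖toSt hφ ((1 : A) ⊗ₜ v)‖ ^ 2 : ℝ) : ℂ)‖ := by
        rw [Complex.norm_real, Real.norm_of_nonneg (by positivity)]
    _ = ‖⟪v, φ 1 v⟫‖ := by rw [h]
    _ ≤ ‖v‖ * ‖φ 1 v‖ := norm_inner_le_norm _ _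
    _ ≤ ‖v‖ * (‖φ 1‖ * ‖v‖) := by gcongr; exact (φ 1).le_opNorm v
    _ = _ := by ring

/-- The embedding `v ↦ 1 ⊗ v`. -/
def stEmbed : K →L[ℂ] Completion (StPre φ hφ) :=
  Completion.toComplL ∘L
    ((toSt hφ).toLinearMap ∘ₗ TensorProduct.mk ℂ A K 1).mkContinuous (√‖φ 1‖) fun v => by
      rw [← sq_le_sq₀ (by positivity) (by positivity), mul_pow, Real.sq_sqrt (by positivity)]
      exact st_embed_bound_sq hφ v

theorem stEmbed_apply (v : K) :
    stEmbed hφ v = ((toSt hφ ((1 : A) ⊗ₜ v) : StPre φ hφ) : Completion (StPre φ hφ)) := rfl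

end StAux

/-- Stinespring's theorem, minimal dilation. Every completely positive
map `φ : A → B(K)` admits a Stinespring representation `(H, π, V)` with
`‖V v‖² ≤ ‖φ(1)‖ ‖v‖²` for all `v ∈ K`, which is minimal in the sense that the span of
`{π(a)(V v) : a ∈ A, v ∈ K}` is dense in `H`; moreover if `φ` is unital then `V` is an
isometry. -/
theorem stinespring_exists_minimal {A : Type u} [CStarAlgebra A]
    {K : Type v} [NormedAddCommGroup K] [InnerProductSpace ℂ K] [CompleteSpace K]
    (φ : A →ₗ[ℂ] (K →L[ℂ] K)) (hφ : IsCPMap φ) :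
    ∃ S : StinespringRep φ,
      (∀ v : K, ‖S.embed v‖ ^ 2 ≤ ‖φ 1‖ * ‖v‖ ^ 2) ∧
      Dense ((Submodule.span ℂ
        {x : S.carrier | ∃ (a : A) (v : K), x = (S.rep a) (S.embed v)} :
          Submodule ℂ S.carrier) : Set S.carrier) ∧
      (φ 1 = 1 → ∀ v : K, ‖S.embed v‖ = ‖v‖) := by
  refine ⟨{ carrier := Completion (StPre φ hφ), rep := stRep hφ, embed := stEmbed hφ,
            stinespring := fun a => ?_ }, fun v => ?_, ?_, fun h1 v => ?_⟩
  · ext v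
    refine ext_inner_left ℂ fun w => ?_
    simp only [ContinuousLinearMap.comp_apply, ContinuousLinearMap.adjoint_inner_right,
      stEmbed_apply, stRep_coe, Completion.inner_coe, stMul_tmul, st_inner, stForm_tmul]
    simp
  · change ‖stEmbed hφ v‖ ^ 2 ≤ _
    rw [stEmbed_apply, Completion.norm_coe]
    exact st_embed_bound_sq hφ v
  · change Dense ((Submodule.span ℂ {x : Completion (StPre φ hφ) |
      ∃ (a : A) (v : K), x = stRep hφ a (stEmbed hφ v)} :
        Submodule ℂ (Completion (StPre φ hφ))) : Set (Completion (StPre φ hφ)))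
    refine Completion.denseRange_coe.mono ?_
    rintro _ ⟨x, rfl⟩
    obtain ⟨n, a, v, hx⟩ := st_exists_sum ((toSt hφ).symm x)
    obtain rfl : x = ∑ i, toSt hφ (a i ⊗ₜ v i) := by
      rw [← map_sum, ← hx, LinearEquiv.apply_symm_apply]
    have : ((∑ i, toSt hφ (a i ⊗ₜ v i) : StPre φ hφ) : Completion (StPre φ hφ)) =
        ∑ i, ((toSt hφ (a i ⊗ₜ v i) : StPre φ hφ) : Completion (StPre φ hφ)) :=
      map_sum (Completion.toComplL (𝕜 := ℂ) (E := StPre φ hφ)) _ _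
    rw [this]
    refine Submodule.sum_mem _ fun i _ => Submodule.subset_span ⟨a i, v i, ?_⟩
    rw [stEmbed_apply, stRep_coe, stMul_tmul, mul_one]
  · change ‖stEmbed hφ v‖ = ‖v‖
    rw [stEmbed_apply, Completion.norm_coe]
    have h := st_embed_norm_sq hφ v
    rw [h1, one_apply_eq_self, inner_self_eq_norm_sq_to_K] at h
    have h' : ‖toSt hφ ((1 : A) ⊗ₜ v)‖ ^ 2 = ‖v‖ ^ 2 := Complex.ofReal_injective (h.trans (by simp))
    exact (sq_eq_sq₀ (norm_nonneg _) (norm_nonneg _)).1 h'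
end
end

section
/- Let A be a unital C*-algebra, let φ : A → B(K) and ψ : A → B(L) be completely positive maps on complex Hilbert spaces K and L, and let T : K → L be a bounded linear map satisfying ψ(a) ∘ T = T ∘ φ(a) for all a ∈ A. Let (H, π, V) be a minimal Stinespring representation of φ and let (I, ρ, W) be any Stinespring representation of ψ. Then there exists a unique bounded linear map S : H → I such that S ∘ π(a) = ρ(a) ∘ S for all a ∈ A, S ∘ V = W ∘ T, and T ∘ V* = W* ∘ S. Furthermore, if φ and ψ are unital and T is an isometry, then S is an isometry. -/
open scoped ComplexOrder ComplexInnerProductSpace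

noncomputable section

section Helpers

variable {A : Type*} [CStarAlgebra A]
    {K : Type*} [NormedAddCommGroup K] [InnerProductSpace ℂ K] [CompleteSpace K]
    {L : Type*} [NormedAddCommGroup L] [InnerProductSpace ℂ L] [CompleteSpace L]
    {H : Type*} [NormedAddCommGroup H] [InnerProductSpace ℂ H] [CompleteSpace H]

/-- The map `∑ a ⊗ v ↦ ∑ π(a) V v` on finitely supported functions. -/
def stSum (π : A →⋆ₐ[ℂ] (H →L[ℂ] H)) (V : K →L[ℂ] H) : (A →₀ K) →ₗ[ℂ] H :=
  Finsupp.lsum ℂ (fun a : A => ((π a).comp V).toLinearMap)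

lemma stSum_single (π : A →⋆ₐ[ℂ] (H →L[ℂ] H)) (V : K →L[ℂ] H) (a : A) (v : K) :
    stSum π V (Finsupp.single a v) = π a (V v) := by
  simp [stSum]

lemma stSum_map (π : A →⋆ₐ[ℂ] (H →L[ℂ] H)) (V : L →L[ℂ] H) (T : K →L[ℂ] L) (x : A →₀ K) :
    stSum π V (Finsupp.mapRange.linearMap T.toLinearMap x) = stSum π (V.comp T) x := by
  induction x using Finsupp.induction_linear with
  | zero => simp
  | add x y hx hy => simp only [map_add, hx, hy]
  | single a v => simp [stSum_single]

lemma inner_rep (π : A →⋆ₐ[ℂ] (H →L[ℂ] H)) (V : K →L[ℂ] H) (φ : A →ₗ[ℂ] (K →L[ℂ] K))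
    (hrep : ∀ a : A, φ a = (ContinuousLinearMap.adjoint V).comp ((π a).comp V))
    (a b : A) (v w : K) :
    ⟪π a (V v), π b (V w)⟫ = ⟪v, φ (star a * b) w⟫ := by
  rw [hrep]
  simp only [ContinuousLinearMap.comp_apply, ContinuousLinearMap.adjoint_inner_right, map_mul,
    map_star, mul_apply_eq_comp, ContinuousLinearMap.star_eq_adjoint]

lemma inner_ext {I : Type*} [NormedAddCommGroup I] [InnerProductSpace ℂ I]
    (p p' : (A →₀ K) →ₗ[ℂ] H) (q q' : (A →₀ K) →ₗ[ℂ] I)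
    (h : ∀ a b v w, ⟪p (Finsupp.single a v), p' (Finsupp.single b w)⟫ =
      ⟪q (Finsupp.single a v), q' (Finsupp.single b w)⟫) (x y : A →₀ K) :
    ⟪p x, p' y⟫ = ⟪q x, q' y⟫ := by
  induction x using Finsupp.induction_linear with
  | zero => simp
  | add x x' hx hy => simp only [map_add, inner_add_left, hx, hy]
  | single a v =>
    induction y using Finsupp.induction_linear with
    | zero => simp
    | add x x' hx hy => simp only [map_add, inner_add_right, hx, hy]
    | single b w => exact h a b v w

lemma exists_root (T : K →L[ℂ] L) (φ : A →ₗ[ℂ] (K →L[ℂ] K))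
    (h : ∀ a, Commute ((ContinuousLinearMap.adjoint T).comp T) (φ a)) :
    ∃ R : K →L[ℂ] K, ContinuousLinearMap.adjoint R = R ∧ (∀ a, Commute R (φ a)) ∧
      R * R = ((‖T‖ ^ 2 : ℝ) : ℂ) • 1 - (ContinuousLinearMap.adjoint T).comp T := by
  set D : K →L[ℂ] K := ((‖T‖ ^ 2 : ℝ) : ℂ) • 1 - (ContinuousLinearMap.adjoint T).comp T with hD
  have hpos : 0 ≤ D := by
    rw [ContinuousLinearMap.nonneg_iff_isPositive,
      ContinuousLinearMap.isPositive_iff_complex]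
    intro x
    have e : ⟪D x, x⟫ = ((‖T‖ ^ 2 * ‖x‖ ^ 2 - ‖T x‖ ^ 2 : ℝ) : ℂ) := by
      simp [hD, inner_sub_left, inner_smul_left, ContinuousLinearMap.adjoint_inner_left,
        inner_self_eq_norm_sq_to_K, mul_comm]
    rw [e]
    refine ⟨by rw [RCLike.re_to_complex, Complex.ofReal_re], ?_⟩
    have h1 := T.le_opNorm x
    have : ‖T x‖ ^ 2 ≤ (‖T‖ * ‖x‖) ^ 2 := by gcongr
    have h2 : 0 ≤ ‖T‖ ^ 2 * ‖x‖ ^ 2 - ‖T x‖ ^ 2 := by nlinarith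
    simpa only [RCLike.re_to_complex, Complex.ofReal_re] using h2
  refine ⟨CFC.sqrt D, ?_, ?_, CFC.sqrt_mul_sqrt_self D hpos⟩
  · exact (CFC.sqrt_nonneg D).isSelfAdjoint
  · intro a
    have hc : Commute D (φ a) := by
      refine Commute.sub_left ?_ (h a)
      exact (Commute.one_left _).smul_left _
    exact hc.cfcₙ_nnreal _

end Helpers

open ContinuousLinearMap in
/-- universal property of the minimal Stinespring representation.
Let `φ : A → B(K)` and `ψ : A → B(L)` be completely positive, let `T : K → L` intertwine
them (`ψ(a) ∘ T = T ∘ φ(a)`), let `(H, π, V)` be a *minimal* Stinespring representation of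
`φ` and `(I, ρ, W)` any Stinespring representation of `ψ`. Then there is a unique bounded
linear map `S : H → I` with `S ∘ π(a) = ρ(a) ∘ S` for all `a`, `S ∘ V = W ∘ T` and
`T ∘ V* = W* ∘ S`. If moreover `φ` and `ψ` are unital and `T` is an isometry, then `S` is
an isometry. -/
theorem exists_unique_morphism_of_stinespring {A : Type*} [CStarAlgebra A]
    {K : Type*} [NormedAddCommGroup K] [InnerProductSpace ℂ K] [CompleteSpace K]
    {L : Type*} [NormedAddCommGroup L] [InnerProductSpace ℂ L] [CompleteSpace L]
    {H : Type*} [NormedAddCommGroup H] [InnerProductSpace ℂ H] [CompleteSpace H]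
    {I : Type*} [NormedAddCommGroup I] [InnerProductSpace ℂ I] [CompleteSpace I]
    (φ : A →ₗ[ℂ] (K →L[ℂ] K)) (ψ : A →ₗ[ℂ] (L →L[ℂ] L))
    (hφ : IsCPMap φ) (hψ : IsCPMap ψ)
    (T : K →L[ℂ] L) (hT : ∀ a : A, (ψ a).comp T = T.comp (φ a))
    (π : A →⋆ₐ[ℂ] (H →L[ℂ] H)) (V : K →L[ℂ] H)
    (hrep : ∀ a : A, φ a = (adjoint V).comp ((π a).comp V))
    (hmin : Dense ((Submodule.span ℂ
      {x : H | ∃ (a : A) (v : K), x = (π a) (V v)} : Submodule ℂ H) : Set H))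
    (ρ : A →⋆ₐ[ℂ] (I →L[ℂ] I)) (W : L →L[ℂ] I)
    (hrep' : ∀ a : A, ψ a = (adjoint W).comp ((ρ a).comp W)) :
    (∃! S : H →L[ℂ] I,
      (∀ a : A, S.comp (π a) = (ρ a).comp S) ∧
      S.comp V = W.comp T ∧
      T.comp (adjoint V) = (adjoint W).comp S) ∧
    (φ 1 = 1 → ψ 1 = 1 → (∀ x : K, ‖T x‖ = ‖x‖) →
      ∀ S : H →L[ℂ] I,
        ((∀ a : A, S.comp (π a) = (ρ a).comp S) ∧
          S.comp V = W.comp T ∧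
          T.comp (adjoint V) = (adjoint W).comp S) →
        ∀ x : H, ‖S x‖ = ‖x‖) := by
  have hadj : ∀ a, adjoint (φ a) = φ (star a) := by
    intro a
    rw [hrep, hrep, map_star, star_eq_adjoint]
    simp [adjoint_comp, ContinuousLinearMap.comp_assoc]
  have hadj' : ∀ a, adjoint (ψ a) = ψ (star a) := by
    intro a
    rw [hrep', hrep', map_star, star_eq_adjoint]
    simp [adjoint_comp, ContinuousLinearMap.comp_assoc]
  have hTs : ∀ a, (adjoint T).comp (ψ a) = (φ a).comp (adjoint T) := by
    intro a
    have := congrArg adjoint (hT (star a))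
    simpa [adjoint_comp, hadj, hadj'] using this
  have hcomm : ∀ a, Commute ((adjoint T).comp T) (φ a) := by
    intro a
    change ((adjoint T).comp T).comp (φ a) = (φ a).comp ((adjoint T).comp T)
    rw [ContinuousLinearMap.comp_assoc, ← hT, ← ContinuousLinearMap.comp_assoc, hTs,
      ContinuousLinearMap.comp_assoc]
  have hdense : DenseRange (stSum π V) := by
    refine Dense.mono ?_ hmin
    rw [← LinearMap.coe_range, SetLike.coe_subset_coe, Submodule.span_le]
    rintro _ ⟨a, v, rfl⟩
    exact ⟨Finsupp.single a v, stSum_single π V a v⟩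
  have key : ∀ x y, ⟪stSum ρ (W.comp T) x, stSum ρ (W.comp T) y⟫ =
      ⟪stSum π (V.comp ((adjoint T).comp T)) x, stSum π V y⟫ := by
    refine inner_ext _ _ _ _ ?_
    intro a b v w
    simp only [stSum_single, comp_apply]
    rw [inner_rep ρ W ψ hrep', inner_rep π V φ hrep, adjoint_inner_left]
    exact congrArg (fun f : K →L[ℂ] L => ⟪T v, f w⟫) (hT _)
  obtain ⟨R, hR1, hR2, hR3⟩ := exists_root T φ hcomm
  have key2 : ∀ x y, ⟪stSum π (V.comp (R * R)) x, stSum π V y⟫ =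
      ⟪stSum π (V.comp R) x, stSum π (V.comp R) y⟫ := by
    refine inner_ext _ _ _ _ ?_
    intro a b v w
    simp only [stSum_single, comp_apply]
    rw [inner_rep π V φ hrep, inner_rep π V φ hrep, mul_apply_eq_comp]
    have h1 : φ (star a * b) (R w) = R (φ (star a * b) w) :=
      (congrArg (fun f : K →L[ℂ] K => f w) (hR2 (star a * b)).eq).symm
    rw [h1, ← adjoint_inner_left R, hR1]
  have hsplit : ∀ x, stSum π (V.comp (R * R)) x =
      ((‖T‖ ^ 2 : ℝ) : ℂ) • stSum π V x - stSum π (V.comp ((adjoint T).comp T)) x := by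
    intro x
    rw [hR3]
    induction x using Finsupp.induction_linear with
    | zero => simp
    | add x y hx hy => simp only [map_add, hx, hy, smul_add]; abel
    | single a v => simp [stSum_single]
  have hbound : ∀ x, ‖stSum ρ (W.comp T) x‖ ≤ ‖T‖ * ‖stSum π V x‖ := by
    intro x
    have h1 := key2 x x
    rw [hsplit, inner_sub_left, ← key, inner_smul_left, inner_self_eq_norm_sq_to_K,
      inner_self_eq_norm_sq_to_K, inner_self_eq_norm_sq_to_K] at h1
    have h2 : ‖T‖ ^ 2 * ‖stSum π V x‖ ^ 2 - ‖stSum ρ (W.comp T) x‖ ^ 2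
        = ‖stSum π (V.comp R) x‖ ^ 2 := by
      rw [Complex.conj_ofReal] at h1
      apply Complex.ofReal_injective
      push_cast at h1 ⊢
      exact h1
    refine (sq_le_sq₀ (norm_nonneg _) (by positivity)).1 ?_
    nlinarith [sq_nonneg ‖stSum π (V.comp R) x‖]
  have hS : ∀ S : H →L[ℂ] I, (∀ a : A, S.comp (π a) = (ρ a).comp S) →
      S.comp V = W.comp T → ∀ x, S (stSum π V x) = stSum ρ (W.comp T) x := by
    intro S h1 h2 x
    induction x using Finsupp.induction_linear with
    | zero => simp
    | add x y hx hy => simp only [map_add, hx, hy]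
    | single a v =>
      rw [stSum_single, stSum_single, ← h2]
      exact congrArg (fun f : H →L[ℂ] I => f (V v)) (h1 a)
  have hext : ∀ {E : Type _} [NormedAddCommGroup E] [InnerProductSpace ℂ E]
      (f g : H →L[ℂ] E), (∀ a v, f (π a (V v)) = g (π a (V v))) → f = g := by
    intro E _ _ f g h
    refine ContinuousLinearMap.ext_on hmin ?_
    rintro _ ⟨a, v, rfl⟩
    exact h a v
  have hext' : ∀ (f g : H →L[ℂ] L), (∀ a v, f (π a (V v)) = g (π a (V v))) → f = g := by
    intro f g h
    refine ContinuousLinearMap.ext_on hmin ?_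
    rintro _ ⟨a, v, rfl⟩
    exact h a v
  refine ⟨?_, ?_⟩
  · have hSe := LinearMap.extendOfNorm_eq hdense ⟨‖T‖, hbound⟩
    set S := (stSum ρ (W.comp T)).extendOfNorm (stSum π V) with hSdef
    have hSa : ∀ a v, S (π a (V v)) = ρ a (W (T v)) := by
      intro a v
      have := hSe (Finsupp.single a v)
      simpa only [stSum_single, comp_apply] using this
    refine ⟨S, ⟨?_, ?_, ?_⟩, ?_⟩
    · intro a
      refine hext _ _ ?_
      intro b v
      have h := hSa (a * b) v
      simp only [map_mul, mul_apply_eq_comp] at h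
      simp only [comp_apply, hSa, h]
    · ext v
      have h := hSa 1 v
      simpa using h
    · refine hext' _ _ ?_
      intro a v
      simp only [comp_apply, hSa]
      have h := congrArg (fun f : K →L[ℂ] L => f v) (hT a)
      simp only [hrep, hrep', comp_apply] at h
      exact h.symm
    · rintro S' ⟨h1, h2, -⟩
      refine hext _ _ ?_
      intro a v
      have := hS S' h1 h2 (Finsupp.single a v)
      rw [stSum_single, stSum_single] at this
      rw [this, hSa, comp_apply]
  · rintro - - hiso S ⟨h1, h2, -⟩ x
    have hTT : (adjoint T).comp T = 1 := by
      exact (ContinuousLinearMap.norm_map_iff_adjoint_comp_self T).1 hiso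
    have hn : ∀ x, ‖S (stSum π V x)‖ = ‖stSum π V x‖ := by
      intro x
      have h3 := key x x
      rw [hTT, ← hS S h1 h2] at h3
      have h4 : V.comp (1 : K →L[ℂ] K) = V := by ext; simp
      rw [h4, inner_self_eq_norm_sq_to_K, inner_self_eq_norm_sq_to_K] at h3
      have h5 : ‖S (stSum π V x)‖ ^ 2 = ‖stSum π V x‖ ^ 2 := by exact_mod_cast h3
      exact (sq_eq_sq₀ (norm_nonneg _) (norm_nonneg _)).1 h5
    exact hdense.induction_on (p := fun x => ‖S x‖ = ‖x‖) x
      (isClosed_eq (by fun_prop) (by fun_prop)) hn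
end
end

section
/- Let A be a unital C*-algebra, K a complex Hilbert space, and φ : A → B(K) a completely positive map. Let (H, π, V) be a minimal Stinespring representation of φ and let (H', π', V') be any Stinespring representation of φ. Then there exists a unique bounded linear map S : H → H' such that S ∘ π(a) = π'(a) ∘ S for all a ∈ A, S ∘ V = V', and V* = V'* ∘ S; moreover this S is an isometry. -/
open scoped ComplexOrder ComplexInnerProductSpace

noncomputable section

open ContinuousLinearMap in
/-- Let `φ : A → B(K)` be completely positive, `(H, π, V)` a *minimal*
Stinespring representation of `φ` and `(H', π', V')` any Stinespring representation of
`φ`. Then there exists a unique bounded linear map `S : H → H'` with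
`S ∘ π(a) = π'(a) ∘ S` for all `a`, `S ∘ V = V'` and `V* = V'* ∘ S`; moreover this `S` is
an isometry. -/
theorem exists_unique_isometry_from_minimal_stinespring {A : Type*} [CStarAlgebra A]
    {K : Type*} [NormedAddCommGroup K] [InnerProductSpace ℂ K] [CompleteSpace K]
    {H : Type*} [NormedAddCommGroup H] [InnerProductSpace ℂ H] [CompleteSpace H]
    {H' : Type*} [NormedAddCommGroup H'] [InnerProductSpace ℂ H'] [CompleteSpace H']
    (φ : A →ₗ[ℂ] (K →L[ℂ] K)) (hφ : IsCPMap φ)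
    (π : A →⋆ₐ[ℂ] (H →L[ℂ] H)) (V : K →L[ℂ] H)
    (hrep : ∀ a : A, φ a = (adjoint V).comp ((π a).comp V))
    (hmin : Dense ((Submodule.span ℂ
      {x : H | ∃ (a : A) (v : K), x = (π a) (V v)} : Submodule ℂ H) : Set H))
    (π' : A →⋆ₐ[ℂ] (H' →L[ℂ] H')) (V' : K →L[ℂ] H')
    (hrep' : ∀ a : A, φ a = (adjoint V').comp ((π' a).comp V')) :
    ∃ S : H →L[ℂ] H',
      ((∀ a : A, S.comp (π a) = (π' a).comp S) ∧
        S.comp V = V' ∧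
        adjoint V = (adjoint V').comp S) ∧
      (∀ x : H, ‖S x‖ = ‖x‖) ∧
      (∀ S' : H →L[ℂ] H',
        ((∀ a : A, S'.comp (π a) = (π' a).comp S') ∧
          S'.comp V = V' ∧
          adjoint V = (adjoint V').comp S') → S' = S) := by
  have hone : ∀ v : K, (π 1) (V v) = V v := fun v => by simp
  have hone' : ∀ v : K, (π' 1) (V' v) = V' v := fun v => by simp
  -- the inner products of generators agree
  have hgen : ∀ (a b : A) (v w : K),
      inner ℂ ((π a) (V v)) ((π b) (V w)) = inner ℂ ((π' a) (V' v)) ((π' b) (V' w)) := by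
    intro a b v w
    have h1 : inner ℂ ((π a) (V v)) ((π b) (V w)) = inner ℂ v (φ (star a * b) w) := by
      rw [hrep, map_mul, map_star, star_eq_adjoint]
      simp [adjoint_inner_right]
    have h2 : inner ℂ ((π' a) (V' v)) ((π' b) (V' w)) = inner ℂ v (φ (star a * b) w) := by
      rw [hrep', map_mul, map_star, star_eq_adjoint]
      simp [adjoint_inner_right]
    rw [h1, h2]
  let F : (A × K →₀ ℂ) →ₗ[ℂ] H := Finsupp.linearCombination ℂ (fun p : A × K => (π p.1) (V p.2))
  let F' : (A × K →₀ ℂ) →ₗ[ℂ] H' :=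
    Finsupp.linearCombination ℂ (fun p : A × K => (π' p.1) (V' p.2))
  have hset : {x : H | ∃ (a : A) (v : K), x = (π a) (V v)}
      = Set.range (fun p : A × K => (π p.1) (V p.2)) := by
    ext x
    simp [eq_comm]
  have hdense : DenseRange F := by
    rw [hset, ← Finsupp.range_linearCombination] at hmin
    exact hmin
  have hinner : ∀ f : A × K →₀ ℂ, inner ℂ (F f) (F f) = inner ℂ (F' f) (F' f) := by
    intro f
    simp only [F, F', Finsupp.linearCombination_apply, Finsupp.sum, sum_inner, inner_sum,
      inner_smul_left, inner_smul_right, hgen]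
  have hnorm : ∀ f, ‖F' f‖ = ‖F f‖ := by
    intro f
    rw [@norm_eq_sqrt_re_inner ℂ, @norm_eq_sqrt_re_inner ℂ, hinner]
  have hb : ∃ C, ∀ f, ‖F' f‖ ≤ C * ‖F f‖ := ⟨1, fun f => by rw [hnorm, one_mul]⟩
  let S : H →L[ℂ] H' := F'.extendOfNorm F
  have hS : ∀ f, S (F f) = F' f := fun f => LinearMap.extendOfNorm_eq hdense hb f
  have hSg : ∀ (a : A) (v : K), S ((π a) (V v)) = (π' a) (V' v) := by
    intro a v
    have := hS (Finsupp.single (a, v) 1)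
    simpa [F, F'] using this
  have hSV : S.comp V = V' := by
    ext v
    have := hSg 1 v
    rwa [hone, hone'] at this
  refine ⟨S, ⟨?_, hSV, ?_⟩, ?_, ?_⟩
  · intro a
    apply ContinuousLinearMap.ext_on hmin
    rintro _ ⟨b, v, rfl⟩
    have := hSg (a * b) v
    rw [map_mul, map_mul] at this
    simpa [hSg] using this
  · apply ContinuousLinearMap.ext_on hmin
    rintro _ ⟨b, v, rfl⟩
    have h := congrArg (fun T : K →L[ℂ] K => T v) ((hrep b).symm.trans (hrep' b))
    simpa [hSg] using h
  · intro x
    refine congrFun (hdense.equalizer (S.continuous.norm) continuous_norm ?_) x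
    funext f
    simp [hS, hnorm]
  · rintro S' ⟨h1, h2, -⟩
    apply ContinuousLinearMap.ext_on hmin
    rintro _ ⟨b, v, rfl⟩
    have e1 := congrArg (fun T : H →L[ℂ] H' => T (V v)) (h1 b)
    have e2 := congrArg (fun T : K →L[ℂ] H' => T v) h2
    simp only [comp_apply] at e1 e2
    rw [hSg, e1, e2]
end
end

section
/- Let A be a unital C*-algebra, K a complex Hilbert space, and φ : A → B(K) a completely positive map. If (H, π, V) and (I, ρ, W) are two minimal Stinespring representations of φ, then there exists a unique unitary U : H → I such that U ∘ π(a) = ρ(a) ∘ U for all a ∈ A and U ∘ V = W. -/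
open scoped ComplexOrder ComplexInnerProductSpace

noncomputable section

open ContinuousLinearMap in
/-- uniqueness of minimal Stinespring representations. If `(H, π, V)`
and `(I, ρ, W)` are two minimal Stinespring representations of a completely positive map
`φ : A → B(K)`, then there is a unique unitary (surjective isometry) `U : H → I` with
`U ∘ π(a) = ρ(a) ∘ U` for all `a ∈ A` and `U ∘ V = W`. -/
theorem minimal_stinespring_unique_up_to_unitary {A : Type*} [CStarAlgebra A]
    {K : Type*} [NormedAddCommGroup K] [InnerProductSpace ℂ K] [CompleteSpace K]
    {H : Type*} [NormedAddCommGroup H] [InnerProductSpace ℂ H] [CompleteSpace H]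
    {I : Type*} [NormedAddCommGroup I] [InnerProductSpace ℂ I] [CompleteSpace I]
    (φ : A →ₗ[ℂ] (K →L[ℂ] K)) (hφ : IsCPMap φ)
    (π : A →⋆ₐ[ℂ] (H →L[ℂ] H)) (V : K →L[ℂ] H)
    (hrep : ∀ a : A, φ a = (adjoint V).comp ((π a).comp V))
    (hmin : Dense ((Submodule.span ℂ
      {x : H | ∃ (a : A) (v : K), x = (π a) (V v)} : Submodule ℂ H) : Set H))
    (ρ : A →⋆ₐ[ℂ] (I →L[ℂ] I)) (W : K →L[ℂ] I)
    (hrep' : ∀ a : A, φ a = (adjoint W).comp ((ρ a).comp W))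
    (hmin' : Dense ((Submodule.span ℂ
      {x : I | ∃ (a : A) (v : K), x = (ρ a) (W v)} : Submodule ℂ I) : Set I)) :
    ∃! U : H →L[ℂ] I,
      (∀ x : H, ‖U x‖ = ‖x‖) ∧ Function.Surjective U ∧
      (∀ a : A, U.comp (π a) = (ρ a).comp U) ∧
      U.comp V = W := by
  have key : ∀ (a b : A) (v w : K), ⟪π a (V v), π b (V w)⟫ = ⟪v, φ (star a * b) w⟫ := by
    intro a b v w
    rw [hrep, map_mul, map_star, ContinuousLinearMap.comp_apply, adjoint_inner_right,
      ContinuousLinearMap.comp_apply, ContinuousLinearMap.mul_apply,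
      ContinuousLinearMap.star_eq_adjoint, adjoint_inner_right]
  have key' : ∀ (a b : A) (v w : K), ⟪ρ a (W v), ρ b (W w)⟫ = ⟪v, φ (star a * b) w⟫ := by
    intro a b v w
    rw [hrep', map_mul, map_star, ContinuousLinearMap.comp_apply, adjoint_inner_right,
      ContinuousLinearMap.comp_apply, ContinuousLinearMap.mul_apply,
      ContinuousLinearMap.star_eq_adjoint, adjoint_inner_right]
  let f : (A × K →₀ ℂ) →ₗ[ℂ] H :=
    Finsupp.linearCombination ℂ (fun p : A × K => π p.1 (V p.2))
  let g : (A × K →₀ ℂ) →ₗ[ℂ] I :=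
    Finsupp.linearCombination ℂ (fun p : A × K => ρ p.1 (W p.2))
  have hf : DenseRange f := by
    have h : {x : H | ∃ (a : A) (v : K), x = (π a) (V v)}
        = Set.range (fun p : A × K => π p.1 (V p.2)) := by
      ext x; simp [eq_comm]
    rw [h, ← Finsupp.range_linearCombination] at hmin
    simpa [DenseRange, LinearMap.coe_range] using hmin
  have hg : DenseRange g := by
    have h : {x : I | ∃ (a : A) (v : K), x = (ρ a) (W v)}
        = Set.range (fun p : A × K => ρ p.1 (W p.2)) := by
      ext x; simp [eq_comm]
    rw [h, ← Finsupp.range_linearCombination] at hmin'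
    simpa [DenseRange, LinearMap.coe_range] using hmin'
  have hinner : ∀ x : A × K →₀ ℂ, ⟪g x, g x⟫ = ⟪f x, f x⟫ := by
    intro x
    simp only [f, g, Finsupp.linearCombination_apply, Finsupp.sum, sum_inner, inner_sum,
      inner_smul_left, inner_smul_right, key, key']
  have hnorm : ∀ x, ‖g (LinearEquiv.refl ℂ _ x)‖ = ‖f x‖ := by
    intro x
    rw [LinearEquiv.refl_apply, @norm_eq_sqrt_re_inner ℂ, @norm_eq_sqrt_re_inner ℂ _ _ _ _ (f x),
      hinner]
  let U := (LinearEquiv.refl ℂ (A × K →₀ ℂ)).extendOfIsometry f g hf hg hnorm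
  have hU : ∀ (a : A) (v : K), U (π a (V v)) = ρ a (W v) := by
    intro a v
    have h := (LinearEquiv.refl ℂ (A × K →₀ ℂ)).extendOfIsometry_eq f g hf hg hnorm
      (Finsupp.single (a, v) 1)
    simpa [f, g] using h
  have hext : ∀ T S : H →L[ℂ] I, (∀ (a : A) (v : K), T (π a (V v)) = S (π a (V v))) → T = S := by
    intro T S h
    refine ContinuousLinearMap.ext_on hmin ?_
    rintro x ⟨a, v, rfl⟩
    exact h a v
  refine ⟨(U : H ≃L[ℂ] I), ⟨fun x => U.norm_map x, U.surjective, ?_, ?_⟩, ?_⟩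
  · intro a
    refine hext _ _ fun b v => ?_
    have h := hU (a * b) v
    simp only [map_mul, ContinuousLinearMap.mul_apply] at h
    simpa [hU] using h
  · ext v
    have h := hU 1 v
    simpa using h
  · rintro T ⟨-, -, hT, hTV⟩
    refine hext _ _ fun a v => ?_
    have h1 : T (π a (V v)) = ρ a (T (V v)) := DFunLike.congr_fun (hT a) (V v)
    have h2 : T (V v) = W v := DFunLike.congr_fun hTV v
    rw [h1, h2]
    exact (hU a v).symm
end
end

section
/- Let H, I, J be finite-dimensional complex inner product spaces with H nontrivial, and let L : I → J be a linear map. Then the map id_H ⊗ L : H ⊗ I → H ⊗ J on the tensor product (equipped with the induced inner products) is a partial isometry if and only if L is a partial isometry. -/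
open scoped TensorProduct ComplexInnerProductSpace

noncomputable section

/-- Let `H`, `I`, `J` be finite-dimensional complex inner product
spaces with `H` nontrivial, and equip `H ⊗ I` and `H ⊗ J` with the induced inner
products: sesquilinear forms `inn₁`, `inn₂` (conjugate-linear in the first variable)
characterized by `⟪h₁ ⊗ v₁, h₂ ⊗ v₂⟫ = ⟪h₁, h₂⟫ ⟪v₁, v₂⟫`. Then for a linear map
`L : I → J`, the map `id_H ⊗ L : H ⊗ I → H ⊗ J` is a partial isometry (preserves the
inner product on the orthogonal complement of its kernel) if and only if `L` is a
partial isometry (is norm-preserving on the orthogonal complement of its kernel). -/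
theorem lTensor_isPartialIsometry_iff {H I J : Type*}
    [NormedAddCommGroup H] [InnerProductSpace ℂ H] [FiniteDimensional ℂ H] [Nontrivial H]
    [NormedAddCommGroup I] [InnerProductSpace ℂ I] [FiniteDimensional ℂ I]
    [NormedAddCommGroup J] [InnerProductSpace ℂ J] [FiniteDimensional ℂ J]
    (inn₁ : (H ⊗[ℂ] I) →ₗ⋆[ℂ] ((H ⊗[ℂ] I) →ₗ[ℂ] ℂ))
    (inn₂ : (H ⊗[ℂ] J) →ₗ⋆[ℂ] ((H ⊗[ℂ] J) →ₗ[ℂ] ℂ))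
    (hinn₁ : ∀ (h₁ h₂ : H) (v₁ v₂ : I),
      inn₁ (h₁ ⊗ₜ[ℂ] v₁) (h₂ ⊗ₜ[ℂ] v₂) = ⟪h₁, h₂⟫ * ⟪v₁, v₂⟫)
    (hinn₂ : ∀ (h₁ h₂ : H) (w₁ w₂ : J),
      inn₂ (h₁ ⊗ₜ[ℂ] w₁) (h₂ ⊗ₜ[ℂ] w₂) = ⟪h₁, h₂⟫ * ⟪w₁, w₂⟫)
    (L : I →ₗ[ℂ] J) :
    (∀ x : H ⊗[ℂ] I,
      (∀ y ∈ LinearMap.ker (LinearMap.lTensor H L), inn₁ y x = 0) →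
      inn₂ (LinearMap.lTensor H L x) (LinearMap.lTensor H L x) = inn₁ x x) ↔
    (∀ x ∈ (LinearMap.ker L)ᗮ, ‖L x‖ = ‖x‖) := by
  constructor
  · intro h x hx
    obtain ⟨e, he⟩ := exists_ne (0 : H)
    rw [LinearMap.orthogonal_ker] at hx
    obtain ⟨z, rfl⟩ := hx
    have key : ∀ y : H ⊗[ℂ] I, inn₁ y (e ⊗ₜ[ℂ] (LinearMap.adjoint L z)) =
        inn₂ (LinearMap.lTensor H L y) (e ⊗ₜ[ℂ] z) := by
      intro y
      induction y with
      | zero => simp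
      | tmul a b => simp [hinn₁, hinn₂, LinearMap.adjoint_inner_right]
      | add a b ha hb => simp [ha, hb]
    have h1 := h (e ⊗ₜ[ℂ] (LinearMap.adjoint L z)) (by
      intro y hy
      rw [key, LinearMap.mem_ker.1 hy]; simp)
    rw [LinearMap.lTensor_tmul, hinn₁, hinn₂] at h1
    have h2 := mul_left_cancel₀ (inner_self_ne_zero.2 he) h1
    rw [inner_self_eq_norm_sq_to_K, inner_self_eq_norm_sq_to_K] at h2
    have h3 : ‖L (LinearMap.adjoint L z)‖ ^ 2 = ‖LinearMap.adjoint L z‖ ^ 2 := by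
      exact_mod_cast h2
    exact (sq_eq_sq₀ (norm_nonneg _) (norm_nonneg _)).1 h3
  · intro h x hx
    let K := (LinearMap.ker L)ᗮ
    let P : I →ₗ[ℂ] I := K.starProjection.toLinearMap
    have hPK : ∀ v, P v ∈ K := fun v => Submodule.starProjection_apply_mem K v
    have hPL : ∀ v, L (P v) = L v := by
      intro v
      have h1 : v - P v ∈ Kᗮ := Submodule.sub_starProjection_mem_orthogonal v
      rw [Submodule.orthogonal_orthogonal, LinearMap.mem_ker, map_sub, sub_eq_zero] at h1
      exact h1.symm
    have hiso : ∀ v w, ⟪L v, L w⟫ = ⟪P v, w⟫ := by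
      intro v w
      let f : K →ₗᵢ[ℂ] J := ⟨L ∘ₗ K.subtype, fun u => h u u.2⟩
      have h1 : ⟪L (P v), L (P w)⟫ = ⟪P v, P w⟫ := f.inner_map_map ⟨P v, hPK v⟩ ⟨P w, hPK w⟩
      rw [← hPL v, ← hPL w, h1]
      have h2 : w - P w ∈ Kᗮ := Submodule.sub_starProjection_mem_orthogonal w
      have h3 := h2 (P v) (hPK v)
      rw [inner_sub_right, sub_eq_zero] at h3
      exact h3.symm
    have key : ∀ a b : H ⊗[ℂ] I, inn₂ (LinearMap.lTensor H L a) (LinearMap.lTensor H L b) =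
        inn₁ (LinearMap.lTensor H P a) b := by
      intro a b
      induction a with
      | zero => simp
      | add a a' ha hb => simp [ha, hb]
      | tmul c v =>
        induction b with
        | zero => simp
        | add a a' ha hb => rw [map_add, map_add, map_add, ha, hb]
        | tmul d w =>
          rw [LinearMap.lTensor_tmul, LinearMap.lTensor_tmul, LinearMap.lTensor_tmul, hinn₁,
            hinn₂, hiso]
    have hLP : L ∘ₗ P = L := LinearMap.ext hPL
    have h4 := hx (LinearMap.lTensor H P x - x) (by
      rw [LinearMap.mem_ker, map_sub, ← LinearMap.lTensor_comp_apply, hLP, sub_self])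
    rw [map_sub, LinearMap.sub_apply, sub_eq_zero] at h4
    rw [key, h4]
end
end

section
/- Let n, k ≥ 1 and let φ : Mₙ(ℂ) → M_k(ℂ) be a completely positive map, identifying M_k(ℂ) with the bounded operators on ℂᵏ. Let (H, π, V) be a Stinespring representation of φ with H a finite-dimensional complex Hilbert space. Then there exist p ∈ ℕ and a unitary R : H → ℂⁿ ⊗ ℂᵖ such that R ∘ π(A) ∘ R* = A ⊗ 1_p for all A ∈ Mₙ(ℂ), and consequently φ(A) = (R ∘ V)* ∘ (A ⊗ 1_p) ∘ (R ∘ V) for all A ∈ Mₙ(ℂ). Here A ⊗ 1_p denotes the operator on ℂⁿ ⊗ ℂᵖ acting as A on the first factor and the identity on the second. -/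
open scoped ComplexOrder ComplexInnerProductSpace

noncomputable section

open scoped Kronecker

open ContinuousLinearMap in
/-- Let `φ : Mₙ(ℂ) → M_k(ℂ) = B(ℂᵏ)` be completely positive and let
`(H, π, V)` be a finite-dimensional Stinespring representation of `φ`. Then there exist
`p ∈ ℕ` and a unitary `R : H → ℂⁿ ⊗ ℂᵖ` (modelled as `EuclideanSpace ℂ (Fin n × Fin p)`,
with `A ⊗ 1ₚ` the Kronecker product `A ⊗ₖ 1`) such that `R ∘ π(A) ∘ R* = A ⊗ 1ₚ` for all
`A ∈ Mₙ(ℂ)`, and consequently `φ(A) = (R V)* ∘ (A ⊗ 1ₚ) ∘ (R V)` for all `A`. -/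
theorem finiteDimensional_stinespring_structure (n k : ℕ) (hn : 1 ≤ n) (hk : 1 ≤ k)
    {H : Type*} [NormedAddCommGroup H] [InnerProductSpace ℂ H] [FiniteDimensional ℂ H]
    (φ : Matrix (Fin n) (Fin n) ℂ →ₗ[ℂ]
      (EuclideanSpace ℂ (Fin k) →L[ℂ] EuclideanSpace ℂ (Fin k)))
    (hφ : IsCPMap φ)
    (π : Matrix (Fin n) (Fin n) ℂ →⋆ₐ[ℂ] (H →L[ℂ] H))
    (V : EuclideanSpace ℂ (Fin k) →L[ℂ] H)
    (hrep : ∀ A : Matrix (Fin n) (Fin n) ℂ,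
      φ A = (adjoint V).comp ((π A).comp V)) :
    ∃ (p : ℕ) (R : H →L[ℂ] EuclideanSpace ℂ (Fin n × Fin p)),
      (∀ x : H, ‖R x‖ = ‖x‖) ∧ Function.Surjective R ∧
      (∀ A : Matrix (Fin n) (Fin n) ℂ,
        R.comp ((π A).comp (adjoint R)) =
          Matrix.toEuclideanCLM (𝕜 := ℂ)
            (A ⊗ₖ (1 : Matrix (Fin p) (Fin p) ℂ))) ∧
      (∀ A : Matrix (Fin n) (Fin n) ℂ,
        φ A = (adjoint (R.comp V)).comp
          ((Matrix.toEuclideanCLM (𝕜 := ℂ)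
            (A ⊗ₖ (1 : Matrix (Fin p) (Fin p) ℂ))).comp (R.comp V))) := by
  classical
  let i0 : Fin n := ⟨0, hn⟩
  let e : Fin n → Fin n → (H →L[ℂ] H) := fun i j => π (Matrix.single i j 1)
  have e_mul : ∀ i j l x, e i j (e j l x) = e i l x := by
    intro i j l x
    have : e i j * e j l = e i l := by
      simp only [e, ← map_mul, Matrix.single_mul_single_same, mul_one]
    rw [← this]; rfl
  have e_mul0 : ∀ i j j' l x, j ≠ j' → e i j (e j' l x) = 0 := by
    intro i j j' l x h
    have : e i j * e j' l = 0 := by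
      simp only [e, ← map_mul, Matrix.single_mul_single_of_ne _ _ _ _ h, map_zero]
    have h2 := DFunLike.congr_fun this x
    exact h2
  have e_adj : ∀ i j x y, ⟪e i j x, y⟫ = ⟪x, e j i y⟫ := by
    intro i j x y
    have : adjoint (e i j) = e j i := by
      rw [← ContinuousLinearMap.star_eq_adjoint]
      simp only [e, ← map_star, Matrix.star_eq_conjTranspose, Matrix.conjTranspose_single, star_one]
    rw [← this, ContinuousLinearMap.adjoint_inner_right]
  have e_sum : ∀ x, ∑ i, e i i x = x := by
    intro x
    have : ∑ i, e i i = 1 := by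
      simp only [e, ← map_sum]
      rw [Matrix.sum_single_one, map_one]
    have h2 := DFunLike.congr_fun this x
    simpa using h2
  have pi_e : ∀ (A : Matrix (Fin n) (Fin n) ℂ) i l x,
      π A (e i l x) = ∑ j, A j i • e j l x := by
    intro A i l x
    have : π A * e i l = ∑ j, A j i • e j l := by
      simp only [e, ← map_mul, ← map_smul, ← map_sum]
      congr 1
      ext a b
      simp [Matrix.sum_apply, Matrix.mul_apply, Matrix.single_apply, ite_and]
    have h2 := DFunLike.congr_fun this x
    simpa using h2
  let K : Submodule ℂ H := LinearMap.range (e i0 i0 : H →ₗ[ℂ] H)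
  have hK : ∀ x ∈ K, e i0 i0 x = x := by
    rintro _ ⟨x, rfl⟩
    exact e_mul _ _ _ _
  let f := stdOrthonormalBasis ℂ K
  let p := Module.finrank ℂ K
  let v : Fin n × Fin p → H := fun q => e q.1 i0 (f q.2 : H)
  have hv : Orthonormal ℂ v := by
    rw [orthonormal_iff_ite]
    rintro ⟨i, a⟩ ⟨j, b⟩
    simp only [v, e_adj]
    by_cases hij : i = j
    · subst hij
      rw [e_mul, hK _ (f b).2, ← Submodule.coe_inner, orthonormal_iff_ite.mp f.orthonormal]
      simp
    · rw [e_mul0 _ _ _ _ _ hij]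
      simp [hij]
  have hspan : ⊤ ≤ Submodule.span ℂ (Set.range v) := by
    intro x _
    rw [← e_sum x]
    refine Submodule.sum_mem _ fun i _ => ?_
    rw [← e_mul i i0 i x]
    have hy : e i0 i x ∈ K := ⟨e i0 i x, e_mul _ _ _ _⟩
    have h1 := f.sum_repr ⟨_, hy⟩
    have h2 := congrArg (Subtype.val) h1
    simp only [Submodule.coe_sum, Submodule.coe_smul] at h2
    rw [← h2, map_sum]
    refine Submodule.sum_mem _ fun a _ => ?_
    rw [map_smul]
    exact Submodule.smul_mem _ _ (Submodule.subset_span ⟨(i, a), rfl⟩)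
  let b := OrthonormalBasis.mk hv hspan
  have hb : ∀ q, b q = v q := fun q => by simp [b]
  let R : H →L[ℂ] EuclideanSpace ℂ (Fin n × Fin p) :=
    (b.repr.toContinuousLinearEquiv : H →L[ℂ] EuclideanSpace ℂ (Fin n × Fin p))
  have hR : ∀ x, R x = b.repr x := fun x => rfl
  have hRadj : adjoint R = (b.repr.symm.toContinuousLinearEquiv :
      EuclideanSpace ℂ (Fin n × Fin p) →L[ℂ] H) :=
    LinearIsometryEquiv.adjoint_eq_symm b.repr
  have key : ∀ A : Matrix (Fin n) (Fin n) ℂ, R.comp (π A) =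
      (Matrix.toEuclideanCLM (𝕜 := ℂ) (A ⊗ₖ (1 : Matrix (Fin p) (Fin p) ℂ))).comp R := by
    intro A
    apply ContinuousLinearMap.coe_injective
    apply b.toBasis.ext
    rintro ⟨i, a⟩
    have h1 : π A (b (i, a)) = ∑ j, A j i • b (j, a) := by
      simp only [hb, v, pi_e]
    simp only [OrthonormalBasis.coe_toBasis, ContinuousLinearMap.coe_coe,
      ContinuousLinearMap.comp_apply, h1, map_sum, map_smul, hR, b.repr_self]
    ext ⟨j, c⟩
    simp [Matrix.one_apply, Matrix.kroneckerMap_apply, Pi.single_apply, ite_and]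
  refine ⟨p, R, fun x => b.repr.norm_map x, b.repr.surjective, fun A => ?_, fun A => ?_⟩
  · rw [← ContinuousLinearMap.comp_assoc, key, hRadj]
    ext1 x
    simp [hR]
  · rw [hrep A, ← ContinuousLinearMap.comp_assoc _ R V, ← key, ContinuousLinearMap.adjoint_comp, hRadj]
    ext1 x
    simp [hR]
end
end

section
/- Let n, k ≥ 1 and let φ : Mₙ(ℂ) → M_k(ℂ) be a completely positive map, identifying M_k(ℂ) with the bounded operators on ℂᵏ. Let (H, π, V) and (I, ρ, W) be Stinespring representations of φ with H and I finite-dimensional complex Hilbert spaces, and suppose the representations π and ρ are unitarily equivalent, i.e. there exists a unitary Q : H → I with Q ∘ π(A) ∘ Q* = ρ(A) for all A ∈ Mₙ(ℂ). Then there exists a unitary U : H → I such that U ∘ π(A) = ρ(A) ∘ U for all A ∈ Mₙ(ℂ) and U ∘ V = W. -/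
open scoped ComplexOrder ComplexInnerProductSpace

noncomputable section

open ContinuousLinearMap in
theorem inner_dilation {K H : Type*} [NormedAddCommGroup K] [InnerProductSpace ℂ K]
    [CompleteSpace K] [NormedAddCommGroup H] [InnerProductSpace ℂ H] [CompleteSpace H]
    (V : K →L[ℂ] H) (P : H →L[ℂ] H) (F : K →L[ℂ] K) (h : F = (adjoint V).comp (P.comp V))
    (x y : K) : ⟪x, F y⟫ = ⟪V x, P (V y)⟫ := by
  rw [h, comp_apply, comp_apply, adjoint_inner_right]

theorem exists_isometry_of_norm_eq {E F : Type*} [AddCommGroup E] [Module ℂ E]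
    [NormedAddCommGroup F] [InnerProductSpace ℂ F] [FiniteDimensional ℂ F]
    (a b : E →ₗ[ℂ] F) (h : ∀ x, ‖a x‖ = ‖b x‖) :
    ∃ T : F →ₗᵢ[ℂ] F, ∀ x, T (a x) = b x := by
  obtain ⟨s, hs⟩ := a.rangeRestrict.exists_rightInverse_of_surjective a.range_rangeRestrict
  have hs' : ∀ y : LinearMap.range a, a (s y) = y := fun y =>
    congrArg Subtype.val (LinearMap.congr_fun hs y)
  let L : LinearMap.range a →ₗᵢ[ℂ] F :=
    { toLinearMap := b ∘ₗ s
      norm_map' := fun y => by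
        change ‖b (s y)‖ = ‖y‖
        rw [← h, hs']; rfl }
  refine ⟨L.extend, fun x => ?_⟩
  have h1 := L.extend_apply (a.rangeRestrict x)
  have h2 : L (a.rangeRestrict x) = b x := by
    change b (s (a.rangeRestrict x)) = b x
    rw [← sub_eq_zero, ← map_sub, ← norm_eq_zero, ← h, map_sub, hs']
    simp
  rw [← h2, ← h1]; rfl

open ContinuousLinearMap in
theorem same_rep_unitary (n : ℕ) (o : Fin n) {K : Type*} [NormedAddCommGroup K]
    [InnerProductSpace ℂ K] [CompleteSpace K]
    {H : Type*} [NormedAddCommGroup H] [InnerProductSpace ℂ H] [FiniteDimensional ℂ H]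
    (π : Matrix (Fin n) (Fin n) ℂ →⋆ₐ[ℂ] (H →L[ℂ] H)) (V W : K →L[ℂ] H)
    (h : ∀ A x y, ⟪V x, π A (V y)⟫ = ⟪W x, π A (W y)⟫) :
    ∃ U : H →L[ℂ] H, (∀ x : H, ‖U x‖ = ‖x‖) ∧
      (∀ A : Matrix (Fin n) (Fin n) ℂ, U.comp (π A) = (π A).comp U) ∧ U.comp V = W := by
  let e : Fin n → Fin n → (H →L[ℂ] H) := fun i j => π (Matrix.single i j 1)
  have emul : ∀ i j l x, e i j (e j l x) = e i l x := fun i j l x => by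
    change (π _ * π _) x = _
    rw [← map_mul, Matrix.single_mul_single_same, one_mul]
  have emul0 : ∀ i j j' l x, j ≠ j' → e i j (e j' l x) = 0 := fun i j j' l x hj => by
    change (π _ * π _) x = _
    rw [← map_mul, Matrix.single_mul_single_of_ne (h := hj)]; simp
  have eadj : ∀ i j x y, ⟪e i j x, y⟫ = ⟪x, e j i y⟫ := fun i j x y => by
    have : e j i = adjoint (e i j) := by
      rw [← star_eq_adjoint, ← map_star]
      congr 1
      rw [Matrix.star_eq_conjTranspose, Matrix.conjTranspose_single, star_one]
    rw [this, adjoint_inner_right]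
  have esum : ∀ x, ∑ i, e i i x = x := fun x => by
    have : ∑ i, e i i = 1 := by
      rw [← map_sum, ← map_one π]
      congr 1
      ext a b
      simp [Matrix.sum_apply, Matrix.single_apply, Matrix.one_apply, ite_and]
    rw [← ContinuousLinearMap.sum_apply, this]; rfl
  let H0 := LinearMap.range (e o o : H →ₗ[ℂ] H)
  have mem0 : ∀ j x, e o j x ∈ H0 := fun j x => ⟨e o j x, emul o o j x⟩
  have fix0 : ∀ y : H0, e o o (y : H) = y := by
    rintro ⟨_, x, rfl⟩; exact emul o o o x
  let c : Fin n → H →ₗ[ℂ] H0 := fun j => LinearMap.codRestrict H0 (e o j : H →ₗ[ℂ] H) (mem0 j)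
  have hc : ∀ j x, ((c j x : H0) : H) = e o j x := fun _ _ => rfl
  let a : (K →L[ℂ] H) → (Fin n → K) →ₗ[ℂ] H0 := fun X =>
    ∑ j, c j ∘ₗ (X : K →ₗ[ℂ] H) ∘ₗ LinearMap.proj j
  have ha : ∀ X f, ((a X f : H0) : H) = ∑ j, e o j (X (f j)) := fun X f => by
    simp [a, LinearMap.sum_apply, hc]
  have hin : ∀ X f, ⟪((a X f : H0) : H), ((a X f : H0) : H)⟫
      = ∑ j, ∑ i, ⟪X (f i), e i j (X (f j))⟫ := fun X f => by
    simp only [ha, sum_inner, inner_sum, eadj, emul]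
    try rw [Finset.sum_comm]
  obtain ⟨T, hT⟩ := exists_isometry_of_norm_eq (a V) (a W) (fun f => by
    have : ⟪((a V f : H0) : H), ((a V f : H0) : H)⟫ = ⟪((a W f : H0) : H), ((a W f : H0) : H)⟫ := by
      rw [hin, hin]
      exact Finset.sum_congr rfl fun j _ => Finset.sum_congr rfl fun i _ => h _ _ _
    rw [inner_self_eq_norm_sq_to_K, inner_self_eq_norm_sq_to_K] at this
    have h2 : ‖((a V f : H0) : H)‖ ^ 2 = ‖((a W f : H0) : H)‖ ^ 2 := by exact_mod_cast this
    exact (sq_eq_sq₀ (norm_nonneg _) (norm_nonneg _)).1 h2)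
  have hsingle : ∀ (X : K →L[ℂ] H) j x, a X (Pi.single j x) = c j (X x) := fun X j x => by
    apply Subtype.ext
    rw [ha, hc, Finset.sum_eq_single j]
    · simp
    · intro i _ hi; simp [Pi.single_eq_of_ne hi]
    · simp
  have hTc : ∀ j x, T (c j (V x)) = c j (W x) := fun j x => by
    rw [← hsingle, hT, hsingle]
  let U0 : H →ₗ[ℂ] H := ∑ i, (e i o : H →ₗ[ℂ] H) ∘ₗ H0.subtype ∘ₗ T.toLinearMap ∘ₗ c i
  have hU0 : ∀ x, U0 x = ∑ i, e i o (T (c i x) : H0) := fun x => by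
    simp [U0, LinearMap.sum_apply]
  refine ⟨LinearMap.toContinuousLinearMap U0, fun x => ?_, fun A => ?_, ?_⟩
  · change ‖U0 x‖ = ‖x‖
    have key : ⟪U0 x, U0 x⟫ = ⟪x, x⟫ := by
      rw [hU0, sum_inner]
      calc _ = ∑ i, ⟪x, e i i x⟫ := by
            refine Finset.sum_congr rfl fun i _ => ?_
            rw [inner_sum, Finset.sum_eq_single i]
            · rw [eadj, emul, fix0, ← Submodule.coe_inner, T.inner_map_map, Submodule.coe_inner, hc,
                eadj, emul]
            · intro j _ hj
              rw [eadj, emul0 _ _ _ _ _ hj.symm, inner_zero_right]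
            · simp
        _ = _ := by rw [← inner_sum, esum]
    rw [inner_self_eq_norm_sq_to_K, inner_self_eq_norm_sq_to_K] at key
    have h2 : ‖U0 x‖ ^ 2 = ‖x‖ ^ 2 := by exact_mod_cast key
    exact (sq_eq_sq₀ (norm_nonneg _) (norm_nonneg _)).1 h2
  · have hcomm : ∀ i j x, U0 (e i j x) = e i j (U0 x) := fun i j x => by
      rw [hU0, hU0, map_sum, Finset.sum_eq_single i, Finset.sum_eq_single j]
      · rw [emul]
        congr 3
        exact Subtype.ext (emul o i j x)
      · intro l _ hl; exact emul0 _ _ _ _ _ hl.symm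
      · simp
      · intro l _ hl
        have : c l (e i j x) = 0 := Subtype.ext (emul0 _ _ _ _ _ hl)
        simp [this]
      · simp
    ext x
    change U0 (π A x) = π A (U0 x)
    have hA : π A = ∑ i, ∑ j, A i j • e i j := by
      conv_lhs => rw [Matrix.matrix_eq_sum_single A]
      simp only [map_sum]
      refine Finset.sum_congr rfl fun i _ => Finset.sum_congr rfl fun j _ => ?_
      rw [← map_smul, Matrix.smul_single, smul_eq_mul, mul_one]
    simp only [hA, ContinuousLinearMap.sum_apply, ContinuousLinearMap.smul_apply, map_sum, map_smul, hcomm]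
  · ext x
    change U0 (V x) = W x
    rw [hU0]
    simp only [hTc, hc, emul, esum]

open ContinuousLinearMap in
/-- essential uniqueness of purifications for matrix algebras. Let
`φ : Mₙ(ℂ) → M_k(ℂ) = B(ℂᵏ)` be completely positive, and let `(H, π, V)` and `(I, ρ, W)`
be finite-dimensional Stinespring representations of `φ` whose representations are
unitarily equivalent via some unitary `Q : H → I` with `Q ∘ π(A) ∘ Q* = ρ(A)`. Then there
exists a unitary `U : H → I` with `U ∘ π(A) = ρ(A) ∘ U` for all `A` and `U ∘ V = W`. -/
theorem purification_essentially_unique_matrix (n k : ℕ) (hn : 1 ≤ n) (hk : 1 ≤ k)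
    {H : Type*} [NormedAddCommGroup H] [InnerProductSpace ℂ H] [FiniteDimensional ℂ H]
    {I : Type*} [NormedAddCommGroup I] [InnerProductSpace ℂ I] [FiniteDimensional ℂ I]
    (φ : Matrix (Fin n) (Fin n) ℂ →ₗ[ℂ]
      (EuclideanSpace ℂ (Fin k) →L[ℂ] EuclideanSpace ℂ (Fin k)))
    (hφ : IsCPMap φ)
    (π : Matrix (Fin n) (Fin n) ℂ →⋆ₐ[ℂ] (H →L[ℂ] H))
    (V : EuclideanSpace ℂ (Fin k) →L[ℂ] H)
    (hrep : ∀ A : Matrix (Fin n) (Fin n) ℂ, φ A = (adjoint V).comp ((π A).comp V))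
    (ρ : Matrix (Fin n) (Fin n) ℂ →⋆ₐ[ℂ] (I →L[ℂ] I))
    (W : EuclideanSpace ℂ (Fin k) →L[ℂ] I)
    (hrep' : ∀ A : Matrix (Fin n) (Fin n) ℂ, φ A = (adjoint W).comp ((ρ A).comp W))
    (Q : H →L[ℂ] I) (hQiso : ∀ x : H, ‖Q x‖ = ‖x‖) (hQsurj : Function.Surjective Q)
    (hQ : ∀ A : Matrix (Fin n) (Fin n) ℂ, Q.comp ((π A).comp (adjoint Q)) = ρ A) :
    ∃ U : H →L[ℂ] I,
      (∀ x : H, ‖U x‖ = ‖x‖) ∧ Function.Surjective U ∧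
      (∀ A : Matrix (Fin n) (Fin n) ℂ, U.comp (π A) = (ρ A).comp U) ∧
      U.comp V = W := by
  have h1 : ∀ x, adjoint Q (Q x) = x := fun x => by
    have := (ContinuousLinearMap.norm_map_iff_adjoint_comp_self Q).1 hQiso
    exact DFunLike.congr_fun this x
  have h2 : ∀ y, Q (adjoint Q y) = y := fun y => by
    obtain ⟨x, rfl⟩ := hQsurj y
    rw [h1]
  have hρ : ∀ A y, ρ A y = Q (π A (adjoint Q y)) := fun A y => by rw [← hQ]; rfl
  obtain ⟨U, hU, hc, hUV⟩ := same_rep_unitary n ⟨0, hn⟩ π V ((adjoint Q).comp W) (fun A x y => by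
    have e1 := inner_dilation V (π A) (φ A) (hrep A) x y
    have e2 := inner_dilation W (ρ A) (φ A) (hrep' A) x y
    rw [hρ, ← adjoint_inner_left Q] at e2
    exact e1.symm.trans e2)
  have hUs : Function.Surjective U := by
    have : Function.Injective (U : H →ₗ[ℂ] H) := by
      rw [injective_iff_map_eq_zero]
      intro x hx
      rw [← norm_eq_zero, ← hU x]
      exact norm_eq_zero.2 hx
    exact LinearMap.injective_iff_surjective.1 this
  refine ⟨Q.comp U, fun x => ?_, hQsurj.comp hUs, fun A => ?_, ?_⟩
  · exact (hQiso (U x)).trans (hU x)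
  · refine ContinuousLinearMap.ext fun x => ?_
    have h3 : U (π A x) = π A (U x) := DFunLike.congr_fun (hc A) x
    change Q (U (π A x)) = ρ A (Q (U x))
    rw [hρ, h1, h3]
  · refine ContinuousLinearMap.ext fun x => ?_
    have h3 : U (V x) = adjoint Q (W x) := DFunLike.congr_fun hUV x
    change Q (U (V x)) = W x
    rw [h3, h2]
end
end

section
/- Let A be a finite-dimensional unital C*-algebra, K a finite-dimensional complex Hilbert space, and φ : A → B(K) a completely positive map. Let (H, π, V) and (I, ρ, W) be Stinespring representations of φ with H and I finite-dimensional complex Hilbert spaces, and suppose there exists a unitary Q : H → I with Q ∘ π(a) ∘ Q* = ρ(a) for all a ∈ A. Then there exists a unitary U : H → I such that U ∘ π(a) = ρ(a) ∘ U for all a ∈ A and U ∘ V = W. -/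
open scoped ComplexOrder ComplexInnerProductSpace

noncomputable section

open Filter Topology TensorProduct
theorem polar_aux {B : Type*} [CStarAlgebra B] [PartialOrder B] [StarOrderedRing B]
    [FiniteDimensional ℂ B] (S : Set B) (w : B) (h1 : ∀ s ∈ S, Commute s w)
    (h2 : ∀ s ∈ S, Commute s (star w)) :
    ∃ u : B, star u * u = 1 ∧ u * star u = 1 ∧ (∀ s ∈ S, Commute s u) ∧ u * CFC.abs w = w := by
  have hfin : (spectrum ℂ w).Finite := by
    obtain ⟨p, hp, hp0⟩ := (Algebra.IsIntegral.isIntegral (R := ℂ) w)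
    refine (p.rootSet_finite ℂ).subset ?_
    intro z hz
    rw [Polynomial.mem_rootSet]
    refine ⟨hp.ne_zero, ?_⟩
    have := spectrum.subset_polynomial_aeval w p ⟨z, hz, rfl⟩
    rw [Polynomial.aeval_def, hp0] at this
    rcases subsingleton_or_nontrivial B with hB | hB
    · exact absurd (isUnit_of_subsingleton _) hz
    · simpa using this
  have hev : ∀ᶠ z : ℂ in 𝓝[≠] 0, IsUnit (w - algebraMap ℂ B z) := by
    have hc : IsClosed (spectrum ℂ w \ {0}) := (hfin.subset Set.sdiff_subset).isClosed
    have : ∀ᶠ z : ℂ in 𝓝[≠] 0, z ∉ spectrum ℂ w \ {0} :=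
      nhdsWithin_le_nhds (hc.isOpen_compl.mem_nhds (by simp))
    filter_upwards [this, self_mem_nhdsWithin] with z hz hz0
    have : z ∉ spectrum ℂ w := fun h => hz ⟨h, hz0⟩
    rw [spectrum.notMem_iff] at this
    simpa using this.neg
  obtain ⟨c, hc0, hc⟩ := exists_seq_forall_of_frequently hev.frequently
  have hc0' : Tendsto c atTop (𝓝 0) := hc0.mono_right nhdsWithin_le_nhds
  set T : ℕ → B := fun n => w - algebraMap ℂ B (c n) with hT
  have hTw : Tendsto T atTop (𝓝 w) := by
    have : Tendsto T atTop (𝓝 (w - algebraMap ℂ B 0)) :=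
      tendsto_const_nhds.sub (((continuous_algebraMap ℂ B).tendsto 0).comp hc0')
    simpa using this
  have key : ∀ n, ∃ u : B, star u * u = 1 ∧ u * star u = 1 ∧ (∀ s ∈ S, Commute s u) ∧
      u * CFC.abs (T n) = T n := by
    intro n
    have hu : IsUnit (T n) := hc n
    have ha : IsUnit (CFC.abs (T n)) := by
      rw [CFC.abs, CFC.isUnit_sqrt_iff _ (star_mul_self_nonneg _)]
      exact hu.star.mul hu
    have hsa : star (CFC.abs (T n)) = CFC.abs (T n) :=
      (IsSelfAdjoint.of_nonneg (CFC.abs_nonneg (T n)))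
    obtain ⟨t, ht⟩ := ha
    have hts : star (↑t⁻¹ : B) = ↑t⁻¹ := by
      have : star t = t := by ext; simpa [ht] using hsa
      rw [← Units.coe_star_inv, this]
    have hiso : star (T n * (↑t⁻¹ : B)) * (T n * ↑t⁻¹) = 1 := by
      rw [star_mul, hts, mul_assoc, ← mul_assoc (star (T n)), ← CFC.abs_mul_abs, ← ht]
      simp
    refine ⟨T n * ↑t⁻¹, hiso, ?_, ?_, ?_⟩
    · have hU : IsUnit (T n * (↑t⁻¹ : B)) := hu.mul t⁻¹.isUnit
      obtain ⟨v, hv⟩ := hU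
      rw [← hv] at hiso ⊢
      have hs : star (v : B) = ↑v⁻¹ := by
        have := congrArg (· * (↑v⁻¹ : B)) hiso
        simpa [mul_assoc] using this
      rw [hs, Units.mul_inv]
    · intro s hs
      have c1 : Commute s (T n) := (h1 s hs).sub_right (Algebra.commutes _ _).symm
      have c2 : Commute s (star (T n)) := by
        simp only [hT, star_sub, ← algebraMap_star_comm]
        exact (h2 s hs).sub_right (Algebra.commutes _ _).symm
      have c3 : Commute s (t : B) := by
        rw [ht]
        exact (c1.symm.cfcAbs_left (by simpa using c2.star_star.symm)).symm
      exact c1.mul_right c3.units_inv_right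
    · rw [← ht]; simp
  choose u hu1 hu2 hu3 hu4 using key
  have : ProperSpace B := FiniteDimensional.proper ℂ B
  have hb : ∀ n, u n ∈ Metric.closedBall (0 : B) 1 := by
    intro n
    rw [mem_closedBall_zero_iff]
    nontriviality B
    have := CStarRing.norm_star_mul_self (x := u n)
    rw [hu1, CStarRing.norm_one] at this
    nlinarith [norm_nonneg (u n)]
  obtain ⟨v, -, f, hf, hv⟩ := (isCompact_closedBall (0 : B) 1).tendsto_subseq hb
  refine ⟨v, ?_, ?_, ?_, ?_⟩
  · refine tendsto_nhds_unique (hv.star.mul hv) ?_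
    simp [hu1]
  · refine tendsto_nhds_unique (hv.mul hv.star) ?_
    simp [hu2]
  · intro s hs
    refine tendsto_nhds_unique (hv.const_mul s) ?_
    refine (hv.mul_const s).congr fun n => ?_
    exact (hu3 _ s hs).eq.symm
  · have hT' := hTw.comp hf.tendsto_atTop
    refine tendsto_nhds_unique (hv.mul ((CFC.continuous_abs.tendsto w).comp hT')) ?_
    refine hT'.congr fun n => ?_
    exact (hu4 _).symm

theorem partial_iso {E H : Type*} [AddCommGroup E] [Module ℂ E]
    [NormedAddCommGroup H] [InnerProductSpace ℂ H] [FiniteDimensional ℂ H] [CompleteSpace H]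
    (L R : E →ₗ[ℂ] H) (hLR : ∀ x y, inner ℂ (L x) (L y) = inner ℂ (R x) (R y)) :
    ∃ w : H →L[ℂ] H, (∀ x, w (L x) = R x) ∧ (∀ y ∈ (LinearMap.range L)ᗮ, w y = 0) ∧
      star w * w = (LinearMap.range L).starProjection := by
  have hker : LinearMap.ker L ≤ LinearMap.ker R := by
    intro x hx
    rw [LinearMap.mem_ker] at *
    rw [← inner_self_eq_zero (𝕜 := ℂ), ← hLR, hx, inner_zero_left]
  let w0 : LinearMap.range L →ₗ[ℂ] H :=
    ((LinearMap.ker L).liftQ R hker) ∘ₗ L.quotKerEquivRange.symm.toLinearMap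
  have hw0 : ∀ x, w0 ⟨L x, LinearMap.mem_range_self L x⟩ = R x := by
    intro x
    have : L.quotKerEquivRange.symm ⟨L x, LinearMap.mem_range_self L x⟩
      = Submodule.Quotient.mk x := by
      rw [LinearEquiv.symm_apply_eq]; rfl
    simp [w0, this]
  let w : H →L[ℂ] H := (LinearMap.toContinuousLinearMap w0) ∘L (LinearMap.range L).orthogonalProjectionOnto
  have hw : ∀ x, w (L x) = R x := by
    intro x
    have : (LinearMap.range L).orthogonalProjectionOnto (L x) = ⟨L x, LinearMap.mem_range_self L x⟩ :=
      Submodule.orthogonalProjectionOnto_mem_subspace_eq_self (K := LinearMap.range L) ⟨L x, LinearMap.mem_range_self L x⟩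
    simp only [w, ContinuousLinearMap.comp_apply, this]
    exact hw0 x
  have hwP : ∀ y, w y = w ((LinearMap.range L).starProjection y) := by
    intro y
    have e : (LinearMap.range L).orthogonalProjectionOnto ((LinearMap.range L).starProjection y) =
        (LinearMap.range L).orthogonalProjectionOnto y :=
      Submodule.orthogonalProjectionOnto_mem_subspace_eq_self (K := LinearMap.range L)
        ((LinearMap.range L).orthogonalProjectionOnto y)
    simp only [w, ContinuousLinearMap.comp_apply, e]
  refine ⟨w, hw, ?_, ?_⟩
  · intro y hy
    rw [hwP, (Submodule.starProjection_apply_eq_zero_iff _).2 hy, map_zero]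
  · ext y
    refine ext_inner_left ℂ fun z => ?_
    rw [mul_apply_eq_comp, ContinuousLinearMap.star_eq_adjoint,
      ContinuousLinearMap.adjoint_inner_right, hwP y, hwP z]
    obtain ⟨a, ha⟩ := (LinearMap.range L).starProjection_apply_mem y
    obtain ⟨b, hb⟩ := (LinearMap.range L).starProjection_apply_mem z
    rw [← ha, ← hb, hw, hw, ← hLR, hb, Submodule.inner_starProjection_left_eq_right, ha]
    congr 1
    rw [Submodule.starProjection_eq_self_iff]
    exact Submodule.starProjection_apply_mem _ y

theorem same_space {A K H : Type*} [CStarAlgebra A]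
    [NormedAddCommGroup K] [InnerProductSpace ℂ K]
    [NormedAddCommGroup H] [InnerProductSpace ℂ H] [FiniteDimensional ℂ H] [CompleteSpace H]
    (π : A →⋆ₐ[ℂ] (H →L[ℂ] H)) (V W : K →L[ℂ] H)
    (h : ∀ a k l, inner ℂ (V k) (π a (V l)) = inner ℂ (W k) (π a (W l))) :
    ∃ u : H →L[ℂ] H, star u * u = 1 ∧ u * star u = 1 ∧ (∀ a, Commute (π a) u) ∧
      ∀ k, u (V k) = W k := by
  let F (X : K →L[ℂ] H) : TensorProduct ℂ A K →ₗ[ℂ] H :=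
    TensorProduct.lift (LinearMap.mk₂ ℂ (fun a k => π a (X k)) (by simp) (by simp) (by simp) (by simp))
  have hF : ∀ X a k, F X (a ⊗ₜ k) = π a (X k) := fun X a k => by simp [F]
  have hstar : ∀ a x y, inner ℂ (π a x) y = inner ℂ x (π (star a) y) := by
    intro a x y
    rw [map_star, ContinuousLinearMap.star_eq_adjoint, ContinuousLinearMap.adjoint_inner_right]
  have hstar' : ∀ a x y, inner ℂ x (π a y) = inner ℂ (π (star a) x) y := by
    intro a x y
    rw [hstar, star_star]
  have hFF : ∀ x y, inner ℂ (F V x) (F V y) = inner ℂ (F W x) (F W y) := by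
    intro x y
    induction x with
    | zero => simp
    | add x₁ x₂ i1 i2 => simp [inner_add_left, i1, i2]
    | tmul a k =>
      induction y with
      | zero => simp
      | add x₁ x₂ i1 i2 => simp [inner_add_right, i1, i2]
      | tmul b l =>
        rw [hF, hF, hF, hF, hstar, hstar, ← mul_apply_eq_comp,
          ← mul_apply_eq_comp, ← map_mul, h]
  obtain ⟨w, hw, hw0, hww⟩ := partial_iso (F V) (F W) hFF
  have hmul : ∀ a x, ∃ y, ∀ X : K →L[ℂ] H, π a (F X x) = F X y := by
    intro a x
    induction x with
    | zero => exact ⟨0, by simp⟩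
    | add x₁ x₂ i1 i2 =>
      obtain ⟨y₁, h₁⟩ := i1
      obtain ⟨y₂, h₂⟩ := i2
      exact ⟨y₁ + y₂, fun X => by simp [h₁, h₂]⟩
    | tmul b k => exact ⟨(a * b) ⊗ₜ k, fun X => by simp [hF]⟩
  have hcomm : ∀ a, Commute (π a) w := by
    intro a
    ext z
    simp only [mul_apply_eq_comp]
    obtain ⟨p, ⟨x, rfl⟩, q, hq, rfl⟩ := (LinearMap.range (F V)).exists_add_mem_mem_orthogonal z
    have hq' : π a q ∈ (LinearMap.range (F V))ᗮ := by
      rw [Submodule.mem_orthogonal]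
      rintro _ ⟨t, rfl⟩
      obtain ⟨y, hy⟩ := hmul (star a) t
      rw [hstar', hy]
      exact (Submodule.mem_orthogonal _ _).1 hq _ ⟨y, rfl⟩
    obtain ⟨y, hy⟩ := hmul a x
    rw [map_add, map_add, map_add, map_add, hw0 q hq, hw0 _ hq', hw, hy, hy, hw, map_zero]
  have hcomm' : ∀ a, Commute (π a) (star w) := by
    intro a
    have := (hcomm (star a)).star_star
    rwa [map_star, star_star] at this
  obtain ⟨u, h1, h2, h3, h4⟩ := polar_aux (Set.range π) w (by rintro _ ⟨a, rfl⟩; exact hcomm a)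
    (by rintro _ ⟨a, rfl⟩; exact hcomm' a)
  refine ⟨u, h1, h2, fun a => h3 _ ⟨a, rfl⟩, fun k => ?_⟩
  have habs : CFC.abs w = star w * w := by
    have hi : (star w * w) * (star w * w) = star w * w := by
      rw [hww]; exact (LinearMap.range (F V)).isIdempotentElem_starProjection
    exact CFC.sqrt_unique hi (star_mul_self_nonneg _)
  have e1 : V k = F V (1 ⊗ₜ k) := by simp [hF]
  have e2 : W k = F W (1 ⊗ₜ k) := by simp [hF]
  have e3 : CFC.abs w (V k) = V k := by
    rw [habs, hww, Submodule.starProjection_eq_self_iff, e1]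
    exact ⟨_, rfl⟩
  rw [← e3, ← mul_apply_eq_comp, h4, e1, hw, e2]

open ContinuousLinearMap in
/-- essential uniqueness of purifications for finite-dimensional
C*-algebras. Let `A` be a finite-dimensional unital C*-algebra, `K` a
finite-dimensional complex Hilbert space and `φ : A → B(K)` completely positive. Let
`(H, π, V)` and `(I, ρ, W)` be finite-dimensional Stinespring representations of `φ`
whose representations are unitarily equivalent via some unitary `Q : H → I` with
`Q ∘ π(a) ∘ Q* = ρ(a)`. Then there exists a unitary `U : H → I` with
`U ∘ π(a) = ρ(a) ∘ U` for all `a ∈ A` and `U ∘ V = W`. -/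
theorem purification_essentially_unique_fd {A : Type*} [CStarAlgebra A]
    [FiniteDimensional ℂ A]
    {K : Type*} [NormedAddCommGroup K] [InnerProductSpace ℂ K] [FiniteDimensional ℂ K]
    {H : Type*} [NormedAddCommGroup H] [InnerProductSpace ℂ H] [FiniteDimensional ℂ H]
    {I : Type*} [NormedAddCommGroup I] [InnerProductSpace ℂ I] [FiniteDimensional ℂ I]
    (φ : A →ₗ[ℂ] (K →L[ℂ] K)) (hφ : IsCPMap φ)
    (π : A →⋆ₐ[ℂ] (H →L[ℂ] H)) (V : K →L[ℂ] H)
    (hrep : ∀ a : A, φ a = (adjoint V).comp ((π a).comp V))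
    (ρ : A →⋆ₐ[ℂ] (I →L[ℂ] I)) (W : K →L[ℂ] I)
    (hrep' : ∀ a : A, φ a = (adjoint W).comp ((ρ a).comp W))
    (Q : H →L[ℂ] I) (hQiso : ∀ x : H, ‖Q x‖ = ‖x‖) (hQsurj : Function.Surjective Q)
    (hQ : ∀ a : A, Q.comp ((π a).comp (adjoint Q)) = ρ a) :
    ∃ U : H →L[ℂ] I,
      (∀ x : H, ‖U x‖ = ‖x‖) ∧ Function.Surjective U ∧
      (∀ a : A, U.comp (π a) = (ρ a).comp U) ∧
      U.comp V = W := by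
  have hQ1 : ∀ x, adjoint Q (Q x) = x := by
    intro x
    have := (ContinuousLinearMap.norm_map_iff_adjoint_comp_self Q).1 hQiso
    exact DFunLike.congr_fun this x
  have hQ2 : ∀ y, Q (adjoint Q y) = y := by
    intro y
    obtain ⟨x, rfl⟩ := hQsurj y
    rw [hQ1]
  have hQa : ∀ a y, ρ a y = Q (π a (adjoint Q y)) := fun a y => by rw [← hQ]; rfl
  obtain ⟨u, h1, h2, h3, h4⟩ := same_space π V ((adjoint Q).comp W) (by
    intro a k l
    have e : adjoint V (π a (V l)) = adjoint W (ρ a (W l)) :=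
      DFunLike.congr_fun ((hrep a).symm.trans (hrep' a)) l
    rw [← adjoint_inner_right, e, adjoint_inner_right, hQa]
    simp only [comp_apply]
    rw [adjoint_inner_left])
  refine ⟨Q.comp u, ?_, ?_, ?_, ?_⟩
  · intro x
    rw [comp_apply, hQiso]
    exact (ContinuousLinearMap.norm_map_iff_adjoint_comp_self u).2 h1 x
  · intro y
    refine ⟨star u (adjoint Q y), ?_⟩
    rw [comp_apply, ← mul_apply_eq_comp u, h2, one_apply_eq_self, hQ2]
  · intro a
    ext x
    simp only [comp_apply]
    rw [hQa, hQ1, ← mul_apply_eq_comp, ← mul_apply_eq_comp, (h3 a).eq]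
  · ext k
    simp only [comp_apply]
    rw [h4, comp_apply, hQ2]
end
end

section
/- Define φ : M₂(ℂ) → ℂ by φ(A) = tr(A)/2, let X be the 2×2 matrix with entries X₁₂ = X₂₁ = 1 and X₁₁ = X₂₂ = 0, define ψ : M₂(ℂ) → M₂(ℂ) by ψ(A) = (1/2)·A + (1/2)·X·A·X, and define T : ℂ → ℂ² by T(λ) = (λ, 0). Then T is an isometry and T* ∘ ψ(A) ∘ T = φ(A) for all A ∈ M₂(ℂ) (where the scalar φ(A) acts on ℂ by multiplication), but there exists A ∈ M₂(ℂ) such that T ∘ φ(A) ≠ ψ(A) ∘ T. (Hence the condition Ad_{T*} ∘ ψ = φ does not imply the intertwining condition for operator-state morphisms.) -/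
noncomputable section

/-- Let `φ : M₂(ℂ) → B(ℂ)` be `φ(A) = (tr A / 2) • 1`, let
`X = !![0,1;1,0]`, let `ψ : M₂(ℂ) → B(ℂ²)` be `ψ(A) = (1/2)·A + (1/2)·X A X` (acting on
`ℂ²`), and let `T : ℂ → ℂ²` be `T(λ) = (λ, 0)`. Then `T` is an isometry with
`T* ∘ ψ(A) ∘ T = φ(A)` for all `A`, yet `T ∘ φ(A) ≠ ψ(A) ∘ T` for some `A ∈ M₂(ℂ)`. -/
theorem adjoint_action_not_intertwining
    (φ : Matrix (Fin 2) (Fin 2) ℂ → (ℂ →L[ℂ] ℂ))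
    (hφ : ∀ A : Matrix (Fin 2) (Fin 2) ℂ,
      φ A = (Matrix.trace A / 2) • (1 : ℂ →L[ℂ] ℂ))
    (X : Matrix (Fin 2) (Fin 2) ℂ) (hX : X = !![0, 1; 1, 0])
    (ψ : Matrix (Fin 2) (Fin 2) ℂ →
      (EuclideanSpace ℂ (Fin 2) →L[ℂ] EuclideanSpace ℂ (Fin 2)))
    (hψ : ∀ A : Matrix (Fin 2) (Fin 2) ℂ,
      ψ A = Matrix.toEuclideanCLM (𝕜 := ℂ)
        ((1 / 2 : ℂ) • A + (1 / 2 : ℂ) • (X * A * X)))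
    (T : ℂ →L[ℂ] EuclideanSpace ℂ (Fin 2))
    (hT : ∀ z : ℂ, T z = EuclideanSpace.single (0 : Fin 2) z) :
    (∀ z : ℂ, ‖T z‖ = ‖z‖) ∧
    (∀ A : Matrix (Fin 2) (Fin 2) ℂ,
      ((ContinuousLinearMap.adjoint T).comp ((ψ A).comp T)) = φ A) ∧
    (∃ A : Matrix (Fin 2) (Fin 2) ℂ, T.comp (φ A) ≠ (ψ A).comp T) := by
  have hadj : ∀ y : EuclideanSpace ℂ (Fin 2), ContinuousLinearMap.adjoint T y = y 0 := by
    intro y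
    apply ext_inner_left ℂ
    intro z
    rw [ContinuousLinearMap.adjoint_inner_right, hT, EuclideanSpace.inner_single_left]
    simp [mul_comm]
  have hc : ∀ (M : Matrix (Fin 2) (Fin 2) ℂ) (z : ℂ) (i : Fin 2),
      (Matrix.toEuclideanCLM (𝕜 := ℂ) M (T z)) i = M i 0 * z := by
    intro M z i
    rw [hT, Matrix.ofLp_toEuclideanCLM]
    simp [Matrix.mulVec, dotProduct, Fin.sum_univ_two]
  refine ⟨fun z => by rw [hT]; simp, fun A => ?_, X, fun h => ?_⟩
  · ext
    rw [ContinuousLinearMap.comp_apply, ContinuousLinearMap.comp_apply, hadj, hψ, hc, hφ, hX]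
    simp [Matrix.mul_apply, Fin.sum_univ_two, Matrix.trace, Matrix.vecMul, dotProduct]
    ring
  · have h1 := congrArg (fun f => (f 1) 1) h
    simp only [ContinuousLinearMap.comp_apply] at h1
    rw [hψ, hc, hT, hX] at h1
    simp [Matrix.mul_apply, Fin.sum_univ_two] at h1
    try norm_num at h1
end
end

section
/- Let A be a unital C*-algebra, K and L complex Hilbert spaces, φ : A → B(K) and ψ : A → B(L) completely positive maps, and T : K → L a bounded linear map satisfying ψ(a) ∘ T = T ∘ φ(a) for all a ∈ A. Then for all a₁, …, aₙ ∈ A and v₁, …, vₙ ∈ K, Σ_{i,j=1}^{n} ⟨T vᵢ, ψ(aᵢ* aⱼ)(T vⱼ)⟩ ≤ ‖T‖² · Σ_{i,j=1}^{n} ⟨vᵢ, φ(aᵢ* aⱼ) vⱼ⟩ (both sides being nonnegative real numbers). -/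
open scoped ComplexOrder ComplexInnerProductSpace

noncomputable section

open scoped InnerProductSpace in
theorem aux_abstract {H₁ H₂ : Type*} [NormedAddCommGroup H₁] [InnerProductSpace ℂ H₁]
    [CompleteSpace H₁] [NormedAddCommGroup H₂] [InnerProductSpace ℂ H₂] [CompleteSpace H₂]
    (P : H₁ →L[ℂ] H₁) (Q : H₂ →L[ℂ] H₂) (X : H₁ →L[ℂ] H₂) (hP : P.IsPositive)
    (hQ : Q.IsPositive) (hX : Q ∘L X = X ∘L P) (C : ℝ) (hC : ∀ w, ‖X w‖ ≤ C * ‖w‖)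
    (v : H₁) : ⟪X v, Q (X v)⟫_ℂ ≤ (C : ℂ) ^ 2 * ⟪v, P v⟫_ℂ := by
  have hX' : X.adjoint ∘L Q = P ∘L X.adjoint := by
    have h := congrArg ContinuousLinearMap.adjoint hX
    rw [ContinuousLinearMap.adjoint_comp, ContinuousLinearMap.adjoint_comp] at h
    rwa [hP.isSelfAdjoint.adjoint_eq, hQ.isSelfAdjoint.adjoint_eq] at h
  have hcomm : Commute P (X.adjoint ∘L X) := by
    change P ∘L (X.adjoint ∘L X) = (X.adjoint ∘L X) ∘L P
    rw [← ContinuousLinearMap.comp_assoc, ← hX', ContinuousLinearMap.comp_assoc, hX,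
      ContinuousLinearMap.comp_assoc]
  have hP0 : 0 ≤ P := (ContinuousLinearMap.nonneg_iff_isPositive P).2 hP
  obtain ⟨R, hRsa, hRR, hRc⟩ : ∃ R : H₁ →L[ℂ] H₁, IsSelfAdjoint R ∧ R * R = P ∧
      Commute R (X.adjoint ∘L X) :=
    ⟨CFC.sqrt P, (CFC.sqrt_nonneg P).isSelfAdjoint, CFC.sqrt_mul_sqrt_self P hP0,
      by rw [CFC.sqrt_eq_cfc]; exact hcomm.cfc_nnreal _⟩
  have hRs : ∀ x y, ⟪R x, y⟫_ℂ = ⟪x, R y⟫_ℂ := fun x y => by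
    conv_rhs => rw [← hRsa.adjoint_eq]
    rw [ContinuousLinearMap.adjoint_inner_right]
  have hPv : P v = R (R v) := by rw [← hRR]; rfl
  have e1 : ⟪X v, Q (X v)⟫_ℂ = ((‖X (R v)‖ ^ 2 : ℝ) : ℂ) := by
    have h1 : Q (X v) = X (P v) := congrArg (fun f => f v) hX
    have h2 : X.adjoint (X (R (R v))) = R (X.adjoint (X (R v))) :=
      (congrArg (fun f => f (R v)) hRc.eq).symm
    rw [h1, hPv, ← ContinuousLinearMap.adjoint_inner_right, h2, ← hRs,
      ContinuousLinearMap.adjoint_inner_right, inner_self_eq_norm_sq_to_K]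
    simp
  have e2 : ⟪v, P v⟫_ℂ = ((‖R v‖ ^ 2 : ℝ) : ℂ) := by
    rw [hPv, ← hRs, inner_self_eq_norm_sq_to_K]
    simp
  rw [e1, e2]
  have h := pow_le_pow_left₀ (norm_nonneg _) (hC (R v)) 2
  rw [mul_pow] at h
  exact_mod_cast h

/-- operator matrix -/
def opMat {n : ℕ} {K L : Type*} [NormedAddCommGroup K] [InnerProductSpace ℂ K]
    [NormedAddCommGroup L] [InnerProductSpace ℂ L] (M : Fin n → Fin n → K →L[ℂ] L) :
    PiLp 2 (fun _ : Fin n => K) →L[ℂ] PiLp 2 (fun _ : Fin n => L) :=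
  ((PiLp.continuousLinearEquiv 2 ℂ (fun _ : Fin n => L)).symm :
      (Fin n → L) →L[ℂ] PiLp 2 (fun _ : Fin n => L)) ∘L
    (ContinuousLinearMap.pi fun i => ∑ j, M i j ∘L PiLp.proj 2 (fun _ : Fin n => K) j)

theorem opMat_apply {n : ℕ} {K L : Type*} [NormedAddCommGroup K] [InnerProductSpace ℂ K]
    [NormedAddCommGroup L] [InnerProductSpace ℂ L] (M : Fin n → Fin n → K →L[ℂ] L)
    (w : PiLp 2 (fun _ : Fin n => K)) (i : Fin n) : opMat M w i = ∑ j, M i j (w j) := by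
  simp [opMat]

theorem cp_pos {A : Type*} [CStarAlgebra A]
    {K : Type*} [NormedAddCommGroup K] [InnerProductSpace ℂ K]
    (φ : A →ₗ[ℂ] (K →L[ℂ] K)) (hφ : IsCPMap φ) (n : ℕ) (a : Fin n → A) (v : Fin n → K) :
    0 ≤ ∑ i, ∑ j, ⟪v i, (φ (star (a i) * a j)) (v j)⟫ := by
  cases n with
  | zero => simp
  | succ m =>
    refine hφ (m + 1) (Matrix.of fun i j => star (a i) * a j)
      ⟨Matrix.of fun i j => if i = 0 then a j else 0, ?_⟩ v
    ext i j
    simp [Matrix.mul_apply, Matrix.star_apply, apply_ite star]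

theorem inner_opMat {n : ℕ} {K : Type*} [NormedAddCommGroup K] [InnerProductSpace ℂ K]
    (M : Fin n → Fin n → K →L[ℂ] K) (w : PiLp 2 (fun _ : Fin n => K)) :
    ⟪w, opMat M w⟫ = ∑ i, ∑ j, ⟪w i, M i j (w j)⟫ := by
  simp [PiLp.inner_apply, opMat_apply, inner_sum]

theorem opMat_pos {A : Type*} [CStarAlgebra A]
    {K : Type*} [NormedAddCommGroup K] [InnerProductSpace ℂ K] [CompleteSpace K]
    (φ : A →ₗ[ℂ] (K →L[ℂ] K)) (hφ : IsCPMap φ) (n : ℕ) (a : Fin n → A) :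
    (opMat fun i j => φ (star (a i) * a j)).IsPositive := by
  rw [ContinuousLinearMap.isPositive_iff_complex]
  intro w
  have h : 0 ≤ ⟪w, opMat (fun i j => φ (star (a i) * a j)) w⟫ := by
    rw [inner_opMat]; exact cp_pos φ hφ n a _
  have h' : 0 ≤ ⟪opMat (fun i j => φ (star (a i) * a j)) w, w⟫ := by
    rw [← inner_conj_symm]; exact star_nonneg_iff.2 h
  obtain ⟨h1, h2⟩ := Complex.nonneg_iff.1 h'
  exact ⟨Complex.ext (by simp) (by simpa using h2), h1⟩

/-- If `φ : A → B(K)` and `ψ : A → B(L)` are completely positive and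
`T : K → L` is a bounded linear map intertwining them (`ψ(a) ∘ T = T ∘ φ(a)` for all `a`),
then for all `a₁, …, aₙ ∈ A` and `v₁, …, vₙ ∈ K`,
`∑ᵢⱼ ⟪T vᵢ, ψ(aᵢ* aⱼ)(T vⱼ)⟫ ≤ ‖T‖² ∑ᵢⱼ ⟪vᵢ, φ(aᵢ* aⱼ) vⱼ⟫`,
both sides being nonnegative real numbers (inequality in the complex order). -/
theorem sum_inner_cpMap_intertwiner_le {A : Type*} [CStarAlgebra A]
    {K : Type*} [NormedAddCommGroup K] [InnerProductSpace ℂ K] [CompleteSpace K]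
    {L : Type*} [NormedAddCommGroup L] [InnerProductSpace ℂ L] [CompleteSpace L]
    (φ : A →ₗ[ℂ] (K →L[ℂ] K)) (ψ : A →ₗ[ℂ] (L →L[ℂ] L))
    (hφ : IsCPMap φ) (hψ : IsCPMap ψ)
    (T : K →L[ℂ] L) (hT : ∀ a : A, (ψ a).comp T = T.comp (φ a))
    (n : ℕ) (a : Fin n → A) (v : Fin n → K) :
    0 ≤ ∑ i, ∑ j, ⟪T (v i), (ψ (star (a i) * a j)) (T (v j))⟫ ∧
    ∑ i, ∑ j, ⟪T (v i), (ψ (star (a i) * a j)) (T (v j))⟫ ≤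
      (‖T‖ : ℂ) ^ 2 * ∑ i, ∑ j, ⟪v i, (φ (star (a i) * a j)) (v j)⟫ := by
  refine ⟨cp_pos ψ hψ n a _, ?_⟩
  set X : PiLp 2 (fun _ : Fin n => K) →L[ℂ] PiLp 2 (fun _ : Fin n => L) :=
    opMat (fun i j => if i = j then T else 0) with hXdef
  have hXa : ∀ w i, X w i = T (w i) := fun w i => by
    rw [hXdef, opMat_apply, Finset.sum_eq_single i]
    · simp
    · intro j _ hj
      simp [Ne.symm hj]
    · simp
  have hT' : ∀ b x, ψ b (T x) = T (φ b x) := fun b x => congrArg (fun f => f x) (hT b)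
  have key := aux_abstract _ _ X (opMat_pos φ hφ n a) (opMat_pos ψ hψ n a)
    (by
      ext w i
      simp only [ContinuousLinearMap.comp_apply, opMat_apply, hXa, hT', map_sum]) ‖T‖
    (fun w => by
      rw [← sq_le_sq₀ (norm_nonneg _) (by positivity), mul_pow, PiLp.norm_sq_eq_of_L2,
        PiLp.norm_sq_eq_of_L2, Finset.mul_sum]
      refine Finset.sum_le_sum fun i _ => ?_
      rw [hXa, ← mul_pow]
      exact pow_le_pow_left₀ (norm_nonneg _) (T.le_opNorm _) 2)
    (WithLp.toLp 2 v)
  simpa only [inner_opMat, hXa] using key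
end
end
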